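/- arXiv:2402.13198 — 2 statements merged into one kernel-verified Lean document; each statement's English description precedes it below -/
import Mathlib

section
/- Fix an integer a ≥ 1 and a real u with 1 < u ≤ 2. For every ε > 0 there exist δ > 0 and x₀ such that for all real x ≥ x₀ and all real v with 1 ≤ v ≤ δ·log x/(log log x), one has #{n ∈ ℕ : 1 ≤ n ≤ x, P⁺(n) ≤ x^{1/u} and P⁺(n+a) ≤ x^{1/v}} ≥ (1 − u/2 − ε)·Ψ(x, x^{1/v}). -/
attribute [local instance] Classical.propDecidable

/-- Largest prime factor, with the convention `Pplus 1 = 1`. -/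
def Pplus (n : ℕ) : ℕ := max 1 (n.primeFactors.sup id)

/-- `Ψ(x,z)`, the number of `z`-friable integers up to `x`. -/
noncomputable def Psi (x z : ℝ) : ℕ :=
  {n : ℕ | 1 ≤ n ∧ (n:ℝ) ≤ x ∧ (Pplus n : ℝ) ≤ z}.ncard

/-- Bessel's inequality for an almost orthogonal family, with the row-sum bound on the
Gram matrix. -/
theorem sum_norm_sq_le_of_gram_row_sum {ι : Type*} (R : Finset ι) (S : Finset ℕ)
    (φ : ι → ℕ → ℂ) (a : ℕ → ℂ) (B : ℝ) (hB0 : 0 ≤ B)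
    (hB : ∀ r ∈ R, ∑ s ∈ R, ‖∑ n ∈ S, φ r n * starRingEnd ℂ (φ s n)‖ ≤ B) :
    ∑ r ∈ R, ‖∑ n ∈ S, a n * φ r n‖ ^ 2 ≤ B * ∑ n ∈ S, ‖a n‖ ^ 2 := by
  set c : ι → ℂ := fun r => starRingEnd ℂ (∑ n ∈ S, a n * φ r n) with hc
  set T : ℝ := ∑ r ∈ R, ‖∑ n ∈ S, a n * φ r n‖ ^ 2 with hT
  set G : ι → ι → ℂ := fun r s => ∑ n ∈ S, φ r n * starRingEnd ℂ (φ s n) with hG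
  have hcn : ∀ r, ‖c r‖ = ‖∑ n ∈ S, a n * φ r n‖ := fun r => by simp [hc, -map_sum]
  have hTc : T = ∑ r ∈ R, ‖c r‖ ^ 2 := by simp [hT, hcn]
  have hT0 : 0 ≤ T := Finset.sum_nonneg fun _ _ => by positivity
  have hGsymm : ∀ r s, ‖G r s‖ = ‖G s r‖ := by
    intro r s
    rw [← Complex.norm_conj (G r s)]
    congr 1
    simp only [hG, map_sum, map_mul, Complex.conj_conj]
    exact Finset.sum_congr rfl fun _ _ => mul_comm _ _
  have hW : ∑ n ∈ S, ‖∑ r ∈ R, c r * φ r n‖ ^ 2 ≤ B * T := by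
    have h1 : ((∑ n ∈ S, ‖∑ r ∈ R, c r * φ r n‖ ^ 2 : ℝ) : ℂ)
        = ∑ r ∈ R, ∑ s ∈ R, c r * starRingEnd ℂ (c s) * G r s := by
      push_cast
      simp_rw [← Complex.mul_conj', map_sum, map_mul, Finset.sum_mul_sum, hG, Finset.mul_sum]
      rw [Finset.sum_comm]
      refine Finset.sum_congr rfl fun r _ => ?_
      rw [Finset.sum_comm]
      refine Finset.sum_congr rfl fun s _ => Finset.sum_congr rfl fun n _ => by ring
    have h2 : ∑ n ∈ S, ‖∑ r ∈ R, c r * φ r n‖ ^ 2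
        ≤ ∑ r ∈ R, ∑ s ∈ R, ‖c r‖ * ‖c s‖ * ‖G r s‖ := by
      have h3 : ∑ n ∈ S, ‖∑ r ∈ R, c r * φ r n‖ ^ 2
          = ‖((∑ n ∈ S, ‖∑ r ∈ R, c r * φ r n‖ ^ 2 : ℝ) : ℂ)‖ := by
        rw [Complex.norm_real, Real.norm_of_nonneg (Finset.sum_nonneg fun _ _ => by positivity)]
      rw [h3, h1]
      refine (norm_sum_le _ _).trans (Finset.sum_le_sum fun r _ =>
        (norm_sum_le _ _).trans (Finset.sum_le_sum fun s _ => ?_))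
      simp
    have h4 : ∑ r ∈ R, ∑ s ∈ R, ‖c r‖ * ‖c s‖ * ‖G r s‖
        ≤ ∑ r ∈ R, ∑ s ∈ R, (‖c r‖ ^ 2 * ‖G r s‖ / 2 + ‖c s‖ ^ 2 * ‖G s r‖ / 2) := by
      refine Finset.sum_le_sum fun r _ => Finset.sum_le_sum fun s _ => ?_
      rw [hGsymm s r]
      nlinarith [mul_nonneg (sq_nonneg (‖c r‖ - ‖c s‖)) (norm_nonneg (G r s))]
    have h5 : ∑ r ∈ R, ∑ s ∈ R, ‖c r‖ ^ 2 * ‖G r s‖ / 2 ≤ B * T / 2 := by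
      rw [hTc, Finset.mul_sum, Finset.sum_div]
      refine Finset.sum_le_sum fun r hr => ?_
      rw [← Finset.sum_div, ← Finset.mul_sum]
      have := mul_le_mul_of_nonneg_left (hB r hr) (sq_nonneg ‖c r‖)
      linarith
    have h6 : ∑ r ∈ R, ∑ s ∈ R, ‖c s‖ ^ 2 * ‖G s r‖ / 2 ≤ B * T / 2 := by
      rw [Finset.sum_comm]; exact h5
    simp_rw [Finset.sum_add_distrib] at h4
    linarith
  have hTle : T ≤ ∑ n ∈ S, ‖a n‖ * ‖∑ r ∈ R, c r * φ r n‖ := by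
    have h1 : (T : ℂ) = ∑ n ∈ S, a n * ∑ r ∈ R, c r * φ r n := by
      rw [hT]
      push_cast
      simp_rw [Finset.mul_sum]
      rw [Finset.sum_comm]
      refine Finset.sum_congr rfl fun r _ => ?_
      rw [← Complex.mul_conj', Finset.sum_mul]
      exact Finset.sum_congr rfl fun n _ => by simp only [hc]; ring
    have h2 : T = ‖(T : ℂ)‖ := by rw [Complex.norm_real, Real.norm_of_nonneg hT0]
    rw [h2, h1]
    exact (norm_sum_le _ _).trans (Finset.sum_le_sum fun n _ => by simp)
  have hsq : T ^ 2 ≤ (∑ n ∈ S, ‖a n‖ ^ 2) * (B * T) :=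
    (pow_le_pow_left₀ hT0 hTle 2).trans ((Finset.sum_mul_sq_le_sq_mul_sq _ _ _).trans
      (mul_le_mul_of_nonneg_left hW (Finset.sum_nonneg fun _ _ => by positivity)))
  rcases hT0.eq_or_lt with h | h
  · rw [← h]
    exact mul_nonneg hB0 (Finset.sum_nonneg fun _ _ => by positivity)
  · nlinarith

/-- `e(t) = exp(2πit)`. -/
noncomputable def expTwoPi (t : ℝ) : ℂ := Complex.exp (Complex.I * ((2 * Real.pi * t : ℝ) : ℂ))

theorem expTwoPi_add (s t : ℝ) : expTwoPi (s + t) = expTwoPi s * expTwoPi t := by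
  rw [expTwoPi, expTwoPi, expTwoPi, ← Complex.exp_add]; congr 1; push_cast; ring

theorem norm_expTwoPi (t : ℝ) : ‖expTwoPi t‖ = 1 := by
  rw [expTwoPi, mul_comm]; exact Complex.norm_exp_ofReal_mul_I _

theorem expTwoPi_neg (t : ℝ) : expTwoPi (-t) = starRingEnd ℂ (expTwoPi t) := by
  rw [expTwoPi, expTwoPi, ← Complex.exp_conj, map_mul, Complex.conj_I, Complex.conj_ofReal]
  congr 1; push_cast; ring

theorem expTwoPi_nat_mul (n : ℕ) (t : ℝ) : expTwoPi (n * t) = expTwoPi t ^ n := by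
  rw [expTwoPi, expTwoPi, ← Complex.exp_nat_mul]; congr 1; push_cast; ring

theorem expTwoPi_int (k : ℤ) : expTwoPi k = 1 := by
  rw [expTwoPi, Complex.exp_eq_one_iff]; exact ⟨k, by push_cast; ring⟩

theorem expTwoPi_fract (t : ℝ) : expTwoPi (Int.fract t) = expTwoPi t := by
  conv_rhs => rw [← Int.floor_add_fract t, expTwoPi_add, expTwoPi_int, one_mul]

theorem norm_sum_expTwoPi_le (N : ℕ) (t : ℝ) (ht : 0 < Int.fract t) :
    ‖∑ n ∈ Finset.range N, expTwoPi (n * t)‖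
      ≤ ((Int.fract t)⁻¹ + (1 - Int.fract t)⁻¹) / 2 := by
  set θ := Int.fract t with hθ
  have hθ1 : θ < 1 := Int.fract_lt_one t
  have hgeom : (∑ n ∈ Finset.range N, expTwoPi (n * t)) * (expTwoPi t - 1) =
      expTwoPi t ^ N - 1 := by
    simp_rw [expTwoPi_nat_mul]; exact geom_sum_mul _ _
  have hlow : 4 * min θ (1 - θ) ≤ ‖expTwoPi t - 1‖ := by
    rw [← expTwoPi_fract, ← hθ, expTwoPi, Complex.norm_exp_I_mul_ofReal_sub_one, norm_mul,
      Real.norm_ofNat, show 2 * Real.pi * θ / 2 = Real.pi * θ by ring]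
    have key : 2 * min θ (1 - θ) ≤ Real.sin (Real.pi * θ) := by
      have hpi := Real.pi_pos
      rcases le_total θ (1 / 2) with h | h
      · have := Real.mul_le_sin (x := Real.pi * θ) (by positivity) (by nlinarith)
        rw [show 2 / Real.pi * (Real.pi * θ) = 2 * θ by field_simp] at this
        linarith [min_le_left θ (1 - θ)]
      · have := Real.mul_le_sin (x := Real.pi * (1 - θ))
          (mul_nonneg hpi.le (by linarith)) (by nlinarith)
        rw [show 2 / Real.pi * (Real.pi * (1 - θ)) = 2 * (1 - θ) by field_simp,
          show Real.pi * (1 - θ) = Real.pi - Real.pi * θ by ring, Real.sin_pi_sub] at this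
        linarith [min_le_right θ (1 - θ)]
    have := Real.le_norm_self (Real.sin (Real.pi * θ))
    linarith
  have hmin : 0 < min θ (1 - θ) := lt_min ht (by linarith)
  have hup : ‖∑ n ∈ Finset.range N, expTwoPi (n * t)‖ * (4 * min θ (1 - θ)) ≤ 2 := by
    refine (mul_le_mul_of_nonneg_left hlow (norm_nonneg _)).trans ?_
    rw [← norm_mul, hgeom]
    refine (norm_sub_le _ _).trans ?_
    rw [norm_pow, norm_expTwoPi]; norm_num
  have h1 : ‖∑ n ∈ Finset.range N, expTwoPi (n * t)‖ ≤ (min θ (1 - θ))⁻¹ / 2 := by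
    rw [le_div_iff₀ two_pos, ← one_div, le_div_iff₀ hmin]; linarith
  refine h1.trans ?_
  have h2 : (0:ℝ) ≤ θ⁻¹ := by positivity
  have h3 : (0:ℝ) ≤ (1 - θ)⁻¹ := inv_nonneg.2 (by linarith)
  rcases min_choice θ (1 - θ) with h | h <;> rw [h] <;> linarith

/-- A set of reals whose differences stay `1/D` away from the integers. -/
def CircleSeparated {ι : Type*} (R : Finset ι) (α : ι → ℝ) (D : ℕ) : Prop :=
  ∀ r ∈ R, ∀ s ∈ R, r ≠ s → ∀ k : ℤ, 1 ≤ D * |α r - α s - k|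

theorem CircleSeparated.sum_inv_fract_le {ι : Type*} {R : Finset ι} {α : ι → ℝ} {D : ℕ}
    (h : CircleSeparated R α D) {r : ι} (hr : r ∈ R) :
    ∑ s ∈ R.erase r, (Int.fract (α s - α r))⁻¹ ≤ D * (1 + Real.log D) := by
  set g : ι → ℕ := fun s => ⌊D * Int.fract (α s - α r)⌋₊ with hg
  have hge : ∀ s ∈ R.erase r, 1 ≤ D * Int.fract (α s - α r) := by
    intro s hs
    obtain ⟨hsr, hs⟩ := Finset.mem_erase.1 hs
    have := h s hs r hr hsr ⌊α s - α r⌋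
    rwa [← Int.fract, abs_of_nonneg (Int.fract_nonneg _)] at this
  have hginj : Set.InjOn g (R.erase r : Finset ι) := by
    intro s hs t ht hst
    have hs' := (Finset.mem_erase.1 (Finset.mem_coe.1 hs)).2
    have ht' := (Finset.mem_erase.1 (Finset.mem_coe.1 ht)).2
    by_contra hne
    have h1 := h s hs' t ht' hne (⌊α s - α r⌋ - ⌊α t - α r⌋)
    have h2 : α s - α t - ((⌊α s - α r⌋ - ⌊α t - α r⌋ : ℤ) : ℝ)
        = Int.fract (α s - α r) - Int.fract (α t - α r) := by
      simp only [Int.fract]; push_cast; ring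
    rw [h2, ← Nat.abs_cast D, ← abs_mul, mul_sub] at h1
    have h3 := Nat.floor_le (show 0 ≤ D * Int.fract (α s - α r) by linarith [hge s hs])
    have h4 := Nat.lt_floor_add_one (D * Int.fract (α s - α r))
    have h5 := Nat.floor_le (show 0 ≤ D * Int.fract (α t - α r) by linarith [hge t ht])
    have h6 := Nat.lt_floor_add_one (D * Int.fract (α t - α r))
    simp only [hg] at hst
    rw [hst] at h3 h4
    rcases le_abs.1 h1 with h | h <;> linarith
  calc ∑ s ∈ R.erase r, (Int.fract (α s - α r))⁻¹
      ≤ ∑ s ∈ R.erase r, D * ((g s : ℕ) : ℝ)⁻¹ := by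
        refine Finset.sum_le_sum fun s hs => ?_
        have h1 := hge s hs
        have h2 : (1:ℝ) ≤ g s := by
          exact_mod_cast Nat.le_floor (by simpa using h1)
        have h3 : (g s : ℝ) ≤ D * Int.fract (α s - α r) := Nat.floor_le (by linarith)
        have hf : 0 < Int.fract (α s - α r) := by
          rcases (Int.fract_nonneg (α s - α r)).eq_or_lt with h0 | h0
          · rw [← h0] at h1; norm_num at h1
          · exact h0
        rw [← div_eq_mul_inv, le_div_iff₀ (by linarith), ← div_eq_inv_mul, div_le_iff₀ hf]
        exact h3
    _ = ∑ k ∈ (R.erase r).image g, D * (k : ℝ)⁻¹ := by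
        rw [Finset.sum_image hginj]
    _ ≤ ∑ k ∈ Finset.Icc 1 D, D * (k : ℝ)⁻¹ := by
        refine Finset.sum_le_sum_of_subset_of_nonneg ?_ fun _ _ _ => by positivity
        intro k hk
        obtain ⟨s, hs, rfl⟩ := Finset.mem_image.1 hk
        rw [Finset.mem_Icc]
        refine ⟨Nat.le_floor (by simpa using hge s hs), ?_⟩
        refine Nat.floor_le_of_le ?_
        have := (Int.fract_lt_one (α s - α r)).le
        have hD : (0:ℝ) ≤ D := Nat.cast_nonneg D
        nlinarith
    _ ≤ D * (1 + Real.log D) := by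
        rw [← Finset.mul_sum]
        refine mul_le_mul_of_nonneg_left ?_ (Nat.cast_nonneg D)
        have := harmonic_le_one_add_log D
        rw [harmonic_eq_sum_Icc] at this
        push_cast at this
        exact this

/-- The additive large sieve inequality, with a logarithmic loss. -/
theorem CircleSeparated.large_sieve {ι : Type*} {R : Finset ι} {α : ι → ℝ} {D : ℕ}
    (h : CircleSeparated R α D) (N : ℕ) (a : ℕ → ℂ) :
    ∑ r ∈ R, ‖∑ n ∈ Finset.range N, a n * expTwoPi (n * α r)‖ ^ 2
      ≤ (N + D * (1 + Real.log D)) * ∑ n ∈ Finset.range N, ‖a n‖ ^ 2 := by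
  refine sum_norm_sq_le_of_gram_row_sum R _ (fun r n => expTwoPi (n * α r)) a _ ?_ ?_
  · have : (0:ℝ) ≤ Real.log D := Real.log_natCast_nonneg D
    positivity
  intro r hr
  have hterm : ∀ s, ∑ n ∈ Finset.range N, expTwoPi (n * α r) * starRingEnd ℂ (expTwoPi (n * α s))
      = ∑ n ∈ Finset.range N, expTwoPi (n * (α r - α s)) := by
    intro s
    refine Finset.sum_congr rfl fun n _ => ?_
    rw [← expTwoPi_neg, ← expTwoPi_add]; congr 1; ring
  simp_rw [hterm]
  rw [← Finset.add_sum_erase _ _ hr]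
  have hneg : CircleSeparated R (fun s => -α s) D := by
    intro s hs t ht hst k
    have := h s hs t ht hst (-k)
    rw [← abs_neg] at this
    convert this using 3; push_cast; ring
  have hdiag : ‖∑ n ∈ Finset.range N, expTwoPi (n * (α r - α r))‖ ≤ N := by
    refine (norm_sum_le _ _).trans ?_
    simp [norm_expTwoPi]
  have hoff : ∑ s ∈ R.erase r, ‖∑ n ∈ Finset.range N, expTwoPi (n * (α r - α s))‖
      ≤ ∑ s ∈ R.erase r, ((Int.fract (-α s - -α r))⁻¹ + (Int.fract (α s - α r))⁻¹) / 2 := by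
    refine Finset.sum_le_sum fun s hs => ?_
    obtain ⟨hsr, hs⟩ := Finset.mem_erase.1 hs
    have hpos : 0 < Int.fract (α r - α s) := by
      refine (Int.fract_nonneg _).lt_of_ne fun h0 => ?_
      have := h r hr s hs (Ne.symm hsr) ⌊α r - α s⌋
      rw [← Int.fract, ← h0] at this
      norm_num at this
    have h1 := norm_sum_expTwoPi_le N (α r - α s) hpos
    have h2 : Int.fract (α s - α r) = 1 - Int.fract (α r - α s) := by
      rw [← neg_sub (α r) (α s), Int.fract_neg hpos.ne']
    rw [h2, show -α s - -α r = α r - α s by ring]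
    exact h1
  rw [← Finset.sum_div, Finset.sum_add_distrib] at hoff
  have h1 := hneg.sum_inv_fract_le hr
  have h2 := h.sum_inv_fract_le hr
  linarith

theorem circleSeparated_div_of_prime {𝒬 : Finset ℕ} {P : ℕ} (hprime : ∀ q ∈ 𝒬, q.Prime)
    (hle : ∀ q ∈ 𝒬, q ≤ P) :
    CircleSeparated (𝒬.sigma fun q => Finset.Ico 1 q)
      (fun r : (_ : ℕ) × ℕ => (r.2 : ℝ) / r.1) (P ^ 2) := by
  rintro ⟨q, b⟩ hr ⟨q', b'⟩ hs hne k
  simp only [Finset.mem_sigma, Finset.mem_Ico] at hr hs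
  obtain ⟨hq, hb1, hb2⟩ := hr
  obtain ⟨hq', hb1', hb2'⟩ := hs
  have hqpos : 0 < q := (hprime q hq).pos
  have hqpos' : 0 < q' := (hprime q' hq').pos
  set w : ℤ := b * q' - b' * q - k * (q * q') with hw
  have hw0 : w ≠ 0 := by
    intro h0
    by_cases hqq : q = q'
    · subst hqq
      have h1 : (b : ℤ) - b' = k * q := by
        have hqz : (q : ℤ) ≠ 0 := by exact_mod_cast hqpos.ne'
        apply mul_right_cancel₀ hqz
        rw [hw] at h0; linarith
      have h2 : (b : ℤ) - b' = 0 := by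
        apply Int.eq_zero_of_abs_lt_dvd (m := (q : ℤ)) ⟨k, by rw [h1]; ring⟩
        rw [abs_lt]; omega
      exact hne (by rw [show b = b' by omega])
    · have h1 : (q : ℤ) ∣ b * q' := ⟨b' + k * q', by rw [hw] at h0; linarith⟩
      have h2 : q ∣ b * q' := by exact_mod_cast h1
      rcases (hprime q hq).dvd_mul.1 h2 with h | h
      · exact absurd (Nat.le_of_dvd hb1 h) (by omega)
      · exact hqq ((Nat.prime_dvd_prime_iff_eq (hprime q hq) (hprime q' hq')).1 h)
  have hwabs : (1 : ℝ) ≤ |(w : ℝ)| := by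
    have := Int.one_le_abs hw0
    exact_mod_cast this
  have heq : ((b : ℝ) / q - b' / q' - k) = w / (q * q') := by
    have : (q : ℝ) ≠ 0 := by positivity
    have : (q' : ℝ) ≠ 0 := by positivity
    rw [hw]; push_cast; field_simp
  have hqP : (q : ℝ) ≤ P := by exact_mod_cast hle q hq
  have hqP' : (q' : ℝ) ≤ P := by exact_mod_cast hle q' hq'
  have hpos : (0:ℝ) < q * q' := by positivity
  show (1:ℝ) ≤ _ * |(b : ℝ) / q - b' / q' - k|
  rw [heq, abs_div, abs_of_pos hpos, mul_div_assoc', le_div_iff₀ hpos, one_mul]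
  push_cast
  have : (q : ℝ) * q' ≤ P ^ 2 := by
    rw [sq]; exact mul_le_mul hqP hqP' (by positivity) (by positivity)
  nlinarith [sq_nonneg (P : ℝ)]

/-- The sum of the weights `a n` over the elements of `S` congruent to `h` modulo `q`. -/
noncomputable def classSum (S : Finset ℕ) (a : ℕ → ℝ) (q : ℕ) (h : ZMod q) : ℝ :=
  ∑ n ∈ S.filter (fun n : ℕ => (n : ZMod q) = h), a n

theorem sum_classSum (S : Finset ℕ) (a : ℕ → ℝ) (q : ℕ) [NeZero q] :
    ∑ h : ZMod q, classSum S a q h = ∑ n ∈ S, a n :=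
  Finset.sum_fiberwise S (fun n : ℕ => (n : ZMod q)) a

theorem expTwoPi_mul_div (n b q : ℕ) [NeZero q] :
    expTwoPi (n * (b / q)) = ZMod.stdAddChar ((b : ZMod q) * (n : ZMod q)) := by
  have h := ZMod.stdAddChar_coe (N := q) ((b * n : ℕ) : ℤ)
  push_cast at h
  rw [h, expTwoPi]
  congr 1; push_cast; ring

theorem sum_norm_sq_expTwoPi_div (S : Finset ℕ) (a : ℕ → ℝ) (q : ℕ) [NeZero q] :
    ∑ b ∈ Finset.range q, ‖∑ n ∈ S, (a n : ℂ) * expTwoPi (n * (b / q))‖ ^ 2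
      = q * ∑ h : ZMod q, classSum S a q h ^ 2 := by
  have hz : ∀ f : ZMod q → ℝ, ∑ b ∈ Finset.range q, f b = ∑ h : ZMod q, f h := by
    intro f
    refine Finset.sum_bij' (fun b _ => (b : ZMod q)) (fun h _ => h.val) ?_ ?_ ?_ ?_ ?_
    · simp
    · intro h _; simpa using h.val_lt
    · intro b hb; exact ZMod.val_cast_of_lt (Finset.mem_range.1 hb)
    · simp
    · simp
  have h1 : ∑ b ∈ Finset.range q, ‖∑ n ∈ S, (a n : ℂ) * expTwoPi (n * (b / q))‖ ^ 2
      = ∑ h : ZMod q, ‖∑ n ∈ S, (a n : ℂ) * ZMod.stdAddChar (h * (n : ZMod q))‖ ^ 2 := by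
    rw [← hz]
    simp_rw [expTwoPi_mul_div]
  rw [h1]
  have key : ((∑ h : ZMod q, ‖∑ n ∈ S, (a n : ℂ) * ZMod.stdAddChar (h * (n : ZMod q))‖ ^ 2 : ℝ) : ℂ)
      = ((q * ∑ h : ZMod q, classSum S a q h ^ 2 : ℝ) : ℂ) := by
    push_cast
    have e1 : ∀ h : ZMod q, (‖∑ n ∈ S, (a n : ℂ) * ZMod.stdAddChar (h * (n : ZMod q))‖ : ℂ) ^ 2
        = ∑ n ∈ S, ∑ m ∈ S,
          (a n : ℂ) * a m * ZMod.stdAddChar (h * ((n : ZMod q) - (m : ZMod q))) := by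
      intro h
      rw [← Complex.mul_conj', map_sum, Finset.sum_mul_sum]
      refine Finset.sum_congr rfl fun n _ => Finset.sum_congr rfl fun m _ => ?_
      rw [map_mul (starRingEnd ℂ), Complex.conj_ofReal, ← AddChar.map_neg_eq_conj, mul_sub,
        sub_eq_add_neg,
        AddChar.map_add_eq_mul]
      ring
    simp_rw [e1]
    rw [Finset.sum_comm]
    have e2 : ∀ n ∈ S, ∑ h : ZMod q, ∑ m ∈ S,
        (a n : ℂ) * a m * ZMod.stdAddChar (h * ((n : ZMod q) - (m : ZMod q)))
        = q * (a n * (classSum S a q n : ℂ)) := by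
      intro n _
      rw [Finset.sum_comm, classSum, Complex.ofReal_sum, Finset.sum_filter, Finset.mul_sum,
        Finset.mul_sum]
      refine Finset.sum_congr rfl fun m _ => ?_
      rw [← Finset.mul_sum, AddChar.sum_mulShift _ (ZMod.isPrimitive_stdAddChar q), ZMod.card]
      by_cases h : (m : ZMod q) = n
      · rw [if_pos h, if_pos (by rw [h, sub_self])]; ring
      · rw [if_neg h, if_neg (by rw [sub_eq_zero]; exact fun h' => h h'.symm)]; simp
    rw [Finset.sum_congr rfl e2, ← Finset.mul_sum]
    congr 1
    rw [← Finset.sum_fiberwise S (fun n : ℕ => (n : ZMod q))]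
    refine Finset.sum_congr rfl fun h _ => ?_
    rw [sq]
    nth_rewrite 2 [classSum]
    rw [Complex.ofReal_sum, Finset.mul_sum]
    refine Finset.sum_congr rfl fun n hn => ?_
    rw [(Finset.mem_filter.1 hn).2, mul_comm]
  exact_mod_cast key

/-- The variance of the class sums of `a` over the nonzero residue classes modulo `q`. -/
noncomputable def unitVariance (S : Finset ℕ) (a : ℕ → ℝ) (q : ℕ) [NeZero q] : ℝ :=
  ∑ h ∈ Finset.univ.erase (0 : ZMod q),
    (classSum S a q h - (∑ h ∈ Finset.univ.erase (0 : ZMod q), classSum S a q h) / (q - 1)) ^ 2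

theorem mul_unitVariance_le (S : Finset ℕ) (a : ℕ → ℝ) (q : ℕ) [NeZero q] (hq : 2 ≤ q) :
    q * unitVariance S a q
      ≤ ∑ b ∈ Finset.Ico 1 q, ‖∑ n ∈ S, (a n : ℂ) * expTwoPi (n * (b / q))‖ ^ 2 := by
  have hq0 : (0:ℝ) < q - 1 := by
    have : (2:ℝ) ≤ q := by exact_mod_cast hq
    linarith
  have hsum := sum_norm_sq_expTwoPi_div S a q
  rw [Finset.range_eq_Ico, Finset.sum_eq_sum_Ico_succ_bot (by omega)] at hsum
  have hzero : ‖∑ n ∈ S, (a n : ℂ) * expTwoPi (n * ((0 : ℕ) / q))‖ ^ 2 = (∑ n ∈ S, a n) ^ 2 := by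
    have h1 : ∑ n ∈ S, (a n : ℂ) * expTwoPi (n * ((0 : ℕ) / q)) = ((∑ n ∈ S, a n : ℝ) : ℂ) := by
      push_cast
      refine Finset.sum_congr rfl fun n _ => ?_
      have := expTwoPi_int 0
      simp only [Int.cast_zero] at this
      simp [this]
    rw [h1, Complex.norm_real, Real.norm_eq_abs, sq_abs]
  rw [hzero, ← sum_classSum S a q, ← Finset.add_sum_erase _ _ (Finset.mem_univ (0 : ZMod q)),
    ← Finset.add_sum_erase (a := (0 : ZMod q)) (f := fun h => classSum S a q h ^ 2) _
      (Finset.mem_univ _)] at hsum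
  set A := classSum S a q 0
  set B := ∑ h ∈ Finset.univ.erase (0 : ZMod q), classSum S a q h with hB
  set V := ∑ h ∈ Finset.univ.erase (0 : ZMod q), classSum S a q h ^ 2 with hV
  have hvar : unitVariance S a q = V - B ^ 2 / (q - 1) := by
    have hcard : ((Finset.univ.erase (0 : ZMod q)).card : ℝ) = q - 1 := by
      rw [Finset.card_erase_of_mem (Finset.mem_univ _), Finset.card_univ, ZMod.card,
        Nat.cast_sub (by omega)]
      simp
    unfold unitVariance
    rw [← hB]
    have : ∀ h, (classSum S a q h - B / (q - 1)) ^ 2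
        = classSum S a q h ^ 2 - 2 * (B / (q - 1)) * classSum S a q h + (B / (q - 1)) ^ 2 := by
      intro h; ring
    simp_rw [this]
    rw [Finset.sum_add_distrib, Finset.sum_sub_distrib, ← Finset.mul_sum, ← hB, ← hV,
      Finset.sum_const, nsmul_eq_mul, hcard]
    field_simp; ring
  have hineq : (A + B) ^ 2 ≤ q * A ^ 2 + q * (B ^ 2 / (q - 1)) := by
    have h1 : (q:ℝ) * A ^ 2 + q * (B ^ 2 / (q - 1)) - (A + B) ^ 2
        = ((q - 1) * A - B) ^ 2 / (q - 1) := by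
      field_simp; ring
    have h2 : 0 ≤ ((q - 1) * A - B) ^ 2 / ((q:ℝ) - 1) := by positivity
    linarith
  rw [hvar]
  simp only [zero_add] at hsum
  nlinarith

/-- The large sieve inequality for the variance over the invertible classes of prime moduli. -/
theorem sum_mul_unitVariance_le {𝒬 : Finset ℕ} {P : ℕ} (hprime : ∀ q ∈ 𝒬, q.Prime)
    (hle : ∀ q ∈ 𝒬, q ≤ P) {N : ℕ} {S : Finset ℕ} (hS : ∀ n ∈ S, n < N) (a : ℕ → ℝ)
    (V : ℕ → ℝ) (hV : ∀ q ∈ 𝒬, ∃ _ : NeZero q, V q = unitVariance S a q) :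
    ∑ q ∈ 𝒬, q * V q
      ≤ (N + (P ^ 2 : ℕ) * (1 + Real.log (P ^ 2 : ℕ))) * ∑ n ∈ S, a n ^ 2 := by
  have hext : ∀ f : ℕ → ℂ, ∑ n ∈ S, (a n : ℂ) * f n
      = ∑ n ∈ Finset.range N, ((if n ∈ S then (a n : ℂ) else 0) * f n) := by
    intro f
    simp_rw [ite_mul, zero_mul]
    rw [← Finset.sum_filter]
    refine Finset.sum_congr ?_ fun _ _ => rfl
    ext n
    simp only [Finset.mem_filter, Finset.mem_range]
    exact ⟨fun h => ⟨hS n h, h⟩, fun h => h.2⟩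
  have hsieve := (circleSeparated_div_of_prime hprime hle).large_sieve N
    (fun n => if n ∈ S then (a n : ℂ) else 0)
  rw [Finset.sum_sigma] at hsieve
  simp_rw [← hext] at hsieve
  have hnorm : ∑ n ∈ Finset.range N, ‖(if n ∈ S then (a n : ℂ) else 0)‖ ^ 2
      = ∑ n ∈ S, a n ^ 2 := by
    have : ∀ n, ‖(if n ∈ S then (a n : ℂ) else 0)‖ ^ 2 = if n ∈ S then a n ^ 2 else 0 := by
      intro n; split_ifs <;> simp
    simp_rw [this]
    rw [← Finset.sum_filter]
    refine Finset.sum_congr ?_ fun _ _ => rfl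
    ext n
    simp only [Finset.mem_filter, Finset.mem_range]
    exact ⟨fun h => h.2, fun h => ⟨hS n h, h⟩⟩
  rw [hnorm] at hsieve
  refine le_trans (Finset.sum_le_sum fun q hq => ?_) hsieve
  obtain ⟨_, hVq⟩ := hV q hq
  rw [hVq]
  exact mul_unitVariance_le S a q (hprime q hq).two_le

theorem sum_mul_comp_cast_eq_sum_classSum (S : Finset ℕ) (α : ℕ → ℝ) (q : ℕ) [NeZero q]
    (g : ZMod q → ℝ) : ∑ m ∈ S, α m * g m = ∑ h : ZMod q, classSum S α q h * g h := by
  rw [← Finset.sum_fiberwise S (fun n : ℕ => (n : ZMod q))]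
  refine Finset.sum_congr rfl fun h _ => ?_
  rw [classSum, Finset.sum_mul]
  exact Finset.sum_congr rfl fun n hn => by rw [(Finset.mem_filter.1 hn).2]

/-- The indicator of `m * n ≡ a (mod q)` minus its average over the invertible classes. -/
noncomputable def congrKernel (a q m n : ℕ) : ℝ :=
  (if (m : ZMod q) * (n : ZMod q) = a then 1 else 0)
    - (if (m : ZMod q) * (n : ZMod q) = 0 then 0 else 1 / ((q : ℝ) - 1))

theorem sq_sum_congrKernel_le {a q : ℕ} [hq : Fact q.Prime] (ha : (a : ZMod q) ≠ 0)
    (S T : Finset ℕ) (α β : ℕ → ℝ) :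
    (∑ m ∈ S, ∑ n ∈ T, α m * β n * congrKernel a q m n) ^ 2
      ≤ unitVariance S α q * unitVariance T β q := by
  set E := Finset.univ.erase (0 : ZMod q) with hE
  have hq1 : (0:ℝ) < q - 1 := by
    have : (2:ℝ) ≤ q := by exact_mod_cast hq.out.two_le
    linarith
  have hcard : (E.card : ℝ) = q - 1 := by
    rw [hE, Finset.card_erase_of_mem (Finset.mem_univ _), Finset.card_univ, ZMod.card,
      Nat.cast_sub hq.out.one_le]
    simp
  set μ₁ := (∑ h ∈ E, classSum S α q h) / ((q : ℝ) - 1) with hμ₁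
  set μ₂ := (∑ h ∈ E, classSum T β q h) / ((q : ℝ) - 1) with hμ₂
  have hmem : ∀ h, h ∈ E ↔ h ≠ 0 := fun h => by simp [hE]
  have hreindex : ∀ f : ZMod q → ℝ, ∑ h ∈ E, f (a * h⁻¹) = ∑ h ∈ E, f h := by
    intro f
    refine Finset.sum_bij' (fun h _ => a * h⁻¹) (fun h _ => a * h⁻¹) ?_ ?_ ?_ ?_ ?_
    · intro h hh; rw [hmem] at hh ⊢; exact mul_ne_zero ha (inv_ne_zero hh)
    · intro h hh; rw [hmem] at hh ⊢; exact mul_ne_zero ha (inv_ne_zero hh)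
    · intro h hh; rw [hmem] at hh; field_simp
    · intro h hh; rw [hmem] at hh; field_simp
    · intro h _; rfl
  have hinner : ∀ m : ℕ, ∑ n ∈ T, β n * congrKernel a q m n
      = if (m : ZMod q) = 0 then 0 else classSum T β q (a * (m : ZMod q)⁻¹) - μ₂ := by
    intro m
    have h1 := sum_mul_comp_cast_eq_sum_classSum T β q (fun k =>
      (if (m : ZMod q) * k = a then 1 else 0)
        - (if (m : ZMod q) * k = 0 then 0 else 1 / ((q : ℝ) - 1)))
    refine Eq.trans (by rfl) (h1.trans ?_)
    split_ifs with hm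
    · refine Finset.sum_eq_zero fun k _ => ?_
      rw [hm, zero_mul, if_neg ha.symm, if_pos rfl]; simp
    · simp_rw [mul_sub]
      rw [Finset.sum_sub_distrib]
      congr 1
      · have : ∀ k : ZMod q, ((m : ZMod q) * k = a) ↔ k = a * (m : ZMod q)⁻¹ := by
          intro k
          constructor
          · intro h; rw [← h]; field_simp
          · intro h; rw [h]; field_simp
        simp_rw [this]
        simp
      · rw [hμ₂, ← Finset.add_sum_erase _ _ (Finset.mem_univ (0 : ZMod q)), Finset.sum_div]
        simp only [mul_zero, if_true, zero_add]
        refine Finset.sum_congr rfl fun k hk => ?_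
        rw [if_neg (mul_ne_zero hm ((hmem k).1 hk))]; ring
  have htotal : ∑ m ∈ S, ∑ n ∈ T, α m * β n * congrKernel a q m n
      = ∑ h ∈ E, (classSum S α q h - μ₁) * (classSum T β q (a * h⁻¹) - μ₂) := by
    simp_rw [mul_assoc, ← Finset.mul_sum]
    simp_rw [hinner]
    rw [sum_mul_comp_cast_eq_sum_classSum S α q (fun h =>
      if h = 0 then 0 else classSum T β q (a * h⁻¹) - μ₂),
      ← Finset.add_sum_erase _ _ (Finset.mem_univ (0 : ZMod q))]
    simp only [if_true, mul_zero, zero_add]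
    have hz : ∑ h ∈ E, μ₁ * (classSum T β q (a * h⁻¹) - μ₂) = 0 := by
      rw [← Finset.mul_sum, Finset.sum_sub_distrib, hreindex (classSum T β q), Finset.sum_const,
        nsmul_eq_mul, hcard, hμ₂]
      field_simp; ring
    simp_rw [sub_mul]
    rw [Finset.sum_sub_distrib, hz, sub_zero]
    exact Finset.sum_congr rfl fun h hh => by rw [if_neg ((hmem h).1 hh)]
  rw [htotal]
  refine (Finset.sum_mul_sq_le_sq_mul_sq _ _ _).trans (le_of_eq ?_)
  rw [hreindex fun k => (classSum T β q k - μ₂) ^ 2]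
  rfl

/-- The bilinear form with kernel `F` on `S × T` has operator norm at most `C`. -/
def BilinearBound (S T : Finset ℕ) (F : ℕ → ℕ → ℝ) (C : ℝ) : Prop :=
  ∀ α β : ℕ → ℝ, |∑ m ∈ S, ∑ n ∈ T, α m * β n * F m n|
    ≤ C * √(∑ m ∈ S, α m ^ 2) * √(∑ n ∈ T, β n ^ 2)

theorem sum_sqrt_mul_sqrt_le {ι : Type*} (s : Finset ι) {f g : ι → ℝ}
    (hf : ∀ i ∈ s, 0 ≤ f i) (hg : ∀ i ∈ s, 0 ≤ g i) :
    ∑ i ∈ s, √(f i) * √(g i) ≤ √(∑ i ∈ s, f i) * √(∑ i ∈ s, g i) := by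
  rw [← Real.sqrt_mul (Finset.sum_nonneg hf)]
  refine Real.le_sqrt_of_sq_le ((Finset.sum_mul_sq_le_sq_mul_sq _ _ _).trans (le_of_eq ?_))
  congr 1
  · exact Finset.sum_congr rfl fun i hi => Real.sq_sqrt (hf i hi)
  · exact Finset.sum_congr rfl fun i hi => Real.sq_sqrt (hg i hi)

/-- The bilinear large sieve bound for the average of `congrKernel` over a range of primes. -/
theorem bilinearBound_sum_congrKernel {𝒬 : Finset ℕ} {Q P a : ℕ} (hQ : 0 < Q)
    (hprime : ∀ q ∈ 𝒬, q.Prime) (hge : ∀ q ∈ 𝒬, Q ≤ q) (hle : ∀ q ∈ 𝒬, q ≤ P)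
    (ha : ∀ q ∈ 𝒬, (a : ZMod q) ≠ 0) {M N : ℕ} {S T : Finset ℕ}
    (hS : ∀ m ∈ S, m < M) (hT : ∀ n ∈ T, n < N) :
    BilinearBound S T (fun m n => ∑ q ∈ 𝒬, Real.log q * congrKernel a q m n)
      (Real.log P / Q * (√(M + (P ^ 2 : ℕ) * (1 + Real.log (P ^ 2 : ℕ)))
        * √(N + (P ^ 2 : ℕ) * (1 + Real.log (P ^ 2 : ℕ))))) := by
  intro α β
  set V₁ : ℕ → ℝ := fun q => if h : q.Prime then
    haveI := NeZero.mk h.ne_zero; unitVariance S α q else 0 with hV₁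
  set V₂ : ℕ → ℝ := fun q => if h : q.Prime then
    haveI := NeZero.mk h.ne_zero; unitVariance T β q else 0 with hV₂
  have hV₁' : ∀ q ∈ 𝒬, ∃ _ : NeZero q, V₁ q = unitVariance S α q := fun q hq =>
    ⟨NeZero.mk (hprime q hq).ne_zero, by simp only [hV₁, dif_pos (hprime q hq)]⟩
  have hV₂' : ∀ q ∈ 𝒬, ∃ _ : NeZero q, V₂ q = unitVariance T β q := fun q hq =>
    ⟨NeZero.mk (hprime q hq).ne_zero, by simp only [hV₂, dif_pos (hprime q hq)]⟩
  have h₁ := sum_mul_unitVariance_le hprime hle hS α V₁ hV₁'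
  have h₂ := sum_mul_unitVariance_le hprime hle hT β V₂ hV₂'
  have hpos₁ : ∀ q ∈ 𝒬, 0 ≤ V₁ q := fun q hq => by
    obtain ⟨_, h⟩ := hV₁' q hq
    rw [h]; exact Finset.sum_nonneg fun _ _ => sq_nonneg _
  have hpos₂ : ∀ q ∈ 𝒬, 0 ≤ V₂ q := fun q hq => by
    obtain ⟨_, h⟩ := hV₂' q hq
    rw [h]; exact Finset.sum_nonneg fun _ _ => sq_nonneg _
  have hQ' : (0:ℝ) < Q := by exact_mod_cast hQ
  have hlogP : 0 ≤ Real.log P := Real.log_natCast_nonneg P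
  have hlog : 0 ≤ Real.log (P ^ 2 : ℕ) := Real.log_natCast_nonneg _
  have hterm : ∀ q ∈ 𝒬, |Real.log q * ∑ m ∈ S, ∑ n ∈ T, α m * β n * congrKernel a q m n|
      ≤ Real.log P / Q * (√(q * V₁ q) * √(q * V₂ q)) := by
    intro q hq
    have : Fact q.Prime := ⟨hprime q hq⟩
    have hqpos : (0:ℝ) < q := by exact_mod_cast (hprime q hq).pos
    have hQq : (Q:ℝ) ≤ q := by exact_mod_cast hge q hq
    obtain ⟨_, e₁⟩ := hV₁' q hq
    obtain ⟨_, e₂⟩ := hV₂' q hq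
    have hsq := sq_sum_congrKernel_le (ha q hq) S T α β
    rw [← e₁, ← e₂] at hsq
    have habs := Real.abs_le_sqrt hsq
    rw [Real.sqrt_mul (hpos₁ q hq)] at habs
    have hlq : Real.log q ≤ Real.log P :=
      Real.log_le_log hqpos (by exact_mod_cast hle q hq)
    rw [abs_mul, abs_of_nonneg (Real.log_natCast_nonneg q), Real.sqrt_mul hqpos.le,
      Real.sqrt_mul hqpos.le, show √(q:ℝ) * √(V₁ q) * (√(q:ℝ) * √(V₂ q))
        = (√(q:ℝ) * √(q:ℝ)) * (√(V₁ q) * √(V₂ q)) by ring, Real.mul_self_sqrt hqpos.le]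
    refine (mul_le_mul hlq habs (abs_nonneg _) hlogP).trans ?_
    have h1 : 1 ≤ (q:ℝ) / Q := by rw [le_div_iff₀ hQ']; linarith
    have h2 : 0 ≤ Real.log P * (√(V₁ q) * √(V₂ q)) := by positivity
    calc Real.log P * (√(V₁ q) * √(V₂ q)) ≤ Real.log P * (√(V₁ q) * √(V₂ q)) * ((q:ℝ) / Q) :=
          le_mul_of_one_le_right h2 h1
      _ = _ := by ring
  have hswap : ∑ m ∈ S, ∑ n ∈ T, α m * β n * ∑ q ∈ 𝒬, Real.log q * congrKernel a q m n
      = ∑ q ∈ 𝒬, Real.log q * ∑ m ∈ S, ∑ n ∈ T, α m * β n * congrKernel a q m n := by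
    simp_rw [Finset.mul_sum]
    simp_rw [Finset.sum_comm (s := T) (t := 𝒬)]
    rw [Finset.sum_comm]
    refine Finset.sum_congr rfl fun q _ => Finset.sum_congr rfl fun m _ =>
      Finset.sum_congr rfl fun n _ => by ring
  rw [hswap]
  have hA : (0:ℝ) ≤ M + (P ^ 2 : ℕ) * (1 + Real.log (P ^ 2 : ℕ)) := by positivity
  have hB : (0:ℝ) ≤ N + (P ^ 2 : ℕ) * (1 + Real.log (P ^ 2 : ℕ)) := by positivity
  calc |∑ q ∈ 𝒬, Real.log q * ∑ m ∈ S, ∑ n ∈ T, α m * β n * congrKernel a q m n|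
      ≤ ∑ q ∈ 𝒬, Real.log P / Q * (√(q * V₁ q) * √(q * V₂ q)) :=
        (Finset.abs_sum_le_sum_abs _ _).trans (Finset.sum_le_sum hterm)
    _ ≤ Real.log P / Q * (√(∑ q ∈ 𝒬, q * V₁ q) * √(∑ q ∈ 𝒬, q * V₂ q)) := by
        rw [← Finset.mul_sum]
        refine mul_le_mul_of_nonneg_left (sum_sqrt_mul_sqrt_le _ ?_ ?_) (by positivity)
        · exact fun q hq => mul_nonneg (Nat.cast_nonneg q) (hpos₁ q hq)
        · exact fun q hq => mul_nonneg (Nat.cast_nonneg q) (hpos₂ q hq)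
    _ ≤ Real.log P / Q * (√((M + (P ^ 2 : ℕ) * (1 + Real.log (P ^ 2 : ℕ))) * ∑ m ∈ S, α m ^ 2)
          * √((N + (P ^ 2 : ℕ) * (1 + Real.log (P ^ 2 : ℕ))) * ∑ n ∈ T, β n ^ 2)) := by
        gcongr
    _ = _ := by
        rw [Real.sqrt_mul hA, Real.sqrt_mul hB]; ring

/-- Restricting a bilinear form to `i m < j n` costs a factor equal to the number of binary digits
of the indices. -/
theorem BilinearBound.ite_lt {S T : Finset ℕ} {F : ℕ → ℕ → ℝ} {C : ℝ} (hC : 0 ≤ C)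
    (h : BilinearBound S T F C) (K : ℕ) (i j : ℕ → ℕ) (hi : ∀ m ∈ S, i m < 2 ^ K)
    (hj : ∀ n ∈ T, j n < 2 ^ K) :
    BilinearBound S T (fun m n => if i m < j n then F m n else 0) (K * C) := by
  induction K generalizing i j with
  | zero =>
    intro α β
    have : ∑ m ∈ S, ∑ n ∈ T, α m * β n * (if i m < j n then F m n else 0) = 0 := by
      refine Finset.sum_eq_zero fun m hm => Finset.sum_eq_zero fun n hn => ?_
      have := hj n hn
      rw [if_neg (by omega), mul_zero]
    rw [this]; simp
  | succ K ih =>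
    intro α β
    have ih' := ih (fun m => i m / 2) (fun n => j n / 2)
      (fun m hm => by have := hi m hm; rw [pow_succ] at this; omega)
      (fun n hn => by have := hj n hn; rw [pow_succ] at this; omega) α β
    set A : ℕ → ℕ → ℝ := fun w m => if i m = 2 * w then α m else 0 with hA
    set B : ℕ → ℕ → ℝ := fun w n => if j n = 2 * w + 1 then β n else 0 with hB
    have hsplit : ∑ m ∈ S, ∑ n ∈ T, α m * β n * (if i m < j n then F m n else 0)
        = ∑ m ∈ S, ∑ n ∈ T, α m * β n * (if i m / 2 < j n / 2 then F m n else 0)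
          + ∑ w ∈ Finset.range (2 ^ K), ∑ m ∈ S, ∑ n ∈ T, A w m * B w n * F m n := by
      rw [Finset.sum_comm (s := Finset.range (2 ^ K)), ← Finset.sum_add_distrib]
      refine Finset.sum_congr rfl fun m hm => ?_
      rw [Finset.sum_comm (s := Finset.range (2 ^ K)), ← Finset.sum_add_distrib]
      refine Finset.sum_congr rfl fun n hn => ?_
      have h1 : ∑ w ∈ Finset.range (2 ^ K), A w m * B w n * F m n
          = if i m % 2 = 0 ∧ j n = i m + 1 then α m * β n * F m n else 0 := by
        rw [Finset.sum_eq_single (i m / 2)]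
        · simp only [hA, hB]
          split_ifs <;> first | omega | simp
        · intro w _ hw
          simp only [hA]
          rw [if_neg (by omega)]; simp
        · intro hw
          have := hi m hm
          rw [pow_succ] at this
          exact absurd (Finset.mem_range.2 (by omega)) hw
      rw [h1]
      split_ifs <;> first | omega | simp
    have hdiag : |∑ w ∈ Finset.range (2 ^ K), ∑ m ∈ S, ∑ n ∈ T, A w m * B w n * F m n|
        ≤ C * √(∑ m ∈ S, α m ^ 2) * √(∑ n ∈ T, β n ^ 2) := by
      have hsub : ∀ (U : Finset ℕ) (k : ℕ → ℕ) (c : ℕ) (γ : ℕ → ℝ),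
          ∑ w ∈ Finset.range (2 ^ K), ∑ m ∈ U, (if k m = 2 * w + c then γ m else 0) ^ 2
            ≤ ∑ m ∈ U, γ m ^ 2 := by
        intro U k c γ
        rw [Finset.sum_comm]
        refine Finset.sum_le_sum fun m _ => ?_
        have h1 : ∀ w, (if k m = 2 * w + c then γ m else 0) ^ 2
            ≤ if w = (k m - c) / 2 then γ m ^ 2 else 0 := by
          intro w
          split_ifs <;> first | omega | simp [sq_nonneg]
        refine (Finset.sum_le_sum fun w _ => h1 w).trans ?_
        rw [Finset.sum_ite_eq']
        split_ifs
        · exact le_rfl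
        · positivity
      calc |∑ w ∈ Finset.range (2 ^ K), ∑ m ∈ S, ∑ n ∈ T, A w m * B w n * F m n|
          ≤ ∑ w ∈ Finset.range (2 ^ K), C * (√(∑ m ∈ S, A w m ^ 2) * √(∑ n ∈ T, B w n ^ 2)) :=
            (Finset.abs_sum_le_sum_abs _ _).trans
              (Finset.sum_le_sum fun w _ => (h (A w) (B w)).trans_eq (mul_assoc _ _ _))
        _ ≤ C * (√(∑ w ∈ Finset.range (2 ^ K), ∑ m ∈ S, A w m ^ 2)
              * √(∑ w ∈ Finset.range (2 ^ K), ∑ n ∈ T, B w n ^ 2)) := by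
            rw [← Finset.mul_sum]
            refine mul_le_mul_of_nonneg_left (sum_sqrt_mul_sqrt_le _ ?_ ?_) hC
            · exact fun w _ => Finset.sum_nonneg fun _ _ => sq_nonneg _
            · exact fun w _ => Finset.sum_nonneg fun _ _ => sq_nonneg _
        _ ≤ C * (√(∑ m ∈ S, α m ^ 2) * √(∑ n ∈ T, β n ^ 2)) := by
            have e1 := hsub S i 0 α
            have e2 := hsub T j 1 β
            simp only [add_zero] at e1
            simp only [hA, hB]
            gcongr
        _ = _ := by ring
    rw [hsplit]
    refine (abs_add_le _ _).trans ((add_le_add ih' hdiag).trans (le_of_eq ?_))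
    push_cast; ring

theorem log_factorial_eq_sum_primesLE (N : ℕ) :
    Real.log N.factorial = ∑ p ∈ N.primesLE, (N.factorial.factorization p : ℝ) * Real.log p := by
  rw [Real.log_nat_eq_sum_factorization]
  refine Finsupp.sum_of_support_subset _ ?_ _ (by simp)
  intro p hp
  rw [Nat.support_factorization, Nat.mem_primeFactors] at hp
  exact Nat.mem_primesLE.2 ⟨(hp.1.dvd_factorial).1 hp.2.1, hp.1⟩

theorem sum_log_div_le {N : ℕ} (hN : 1 ≤ N) :
    ∑ p ∈ N.primesLE, Real.log p / p ≤ Real.log N + Real.log 4 := by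
  have hN' : (0:ℝ) < N := by exact_mod_cast hN
  have h1 : ∑ p ∈ N.primesLE, ((N:ℝ) / p - 1) * Real.log p ≤ Real.log N.factorial := by
    rw [log_factorial_eq_sum_primesLE]
    refine Finset.sum_le_sum fun p hp => ?_
    have hpp := (Nat.mem_primesLE.1 hp).2
    refine mul_le_mul_of_nonneg_right ?_ (Real.log_natCast_nonneg p)
    have h2 : N / p ≤ N.factorial.factorization p := by
      rw [Nat.factorization_factorial hpp (Nat.lt_succ_self _)]
      have hmem : 1 ∈ Finset.Ico 1 (Nat.log p N).succ := by
        rw [Finset.mem_Ico]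
        have := Nat.log_pos hpp.one_lt (Nat.mem_primesLE.1 hp).1
        omega
      simpa using Finset.single_le_sum (f := fun i => N / p ^ i) (fun _ _ => Nat.zero_le _) hmem
    have h3 : (N:ℝ) / p < (N / p : ℕ) + 1 := by
      rw [div_lt_iff₀ (by exact_mod_cast hpp.pos)]
      have := Nat.lt_div_mul_add hpp.pos (a := N)
      have h4 : N < (N / p + 1) * p := by linarith
      exact_mod_cast h4
    have h5 : ((N / p : ℕ) : ℝ) ≤ N.factorial.factorization p := by exact_mod_cast h2
    linarith
  have h2 : Real.log N.factorial ≤ N * Real.log N := by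
    rw [← Real.log_pow]
    exact Real.log_le_log (by exact_mod_cast N.factorial_pos) (by exact_mod_cast N.factorial_le_pow)
  have h3 : ∑ p ∈ N.primesLE, Real.log p ≤ Real.log 4 * N := by
    rw [← Chebyshev.theta_eq_sum_primesLE_log]
    exact Chebyshev.theta_le_log4_mul_x hN'.le
  have h4 : ∑ p ∈ N.primesLE, ((N:ℝ) / p - 1) * Real.log p
      = N * ∑ p ∈ N.primesLE, Real.log p / p - ∑ p ∈ N.primesLE, Real.log p := by
    rw [Finset.mul_sum, ← Finset.sum_sub_distrib]
    exact Finset.sum_congr rfl fun p _ => by ring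
  have h5 : (N:ℝ) * ∑ p ∈ N.primesLE, Real.log p / p ≤ N * (Real.log N + Real.log 4) := by
    linarith
  exact le_of_mul_le_mul_left h5 hN'

theorem exists_le_sum_log_div :
    ∃ C : ℝ, ∀ N : ℕ, 1 ≤ N → Real.log N - C ≤ ∑ p ∈ N.primesLE, Real.log p / p := by
  have hsum : Summable fun n : ℕ => 4 * (n : ℝ) ^ (-(3 / 2) : ℝ) :=
    (Real.summable_nat_rpow.2 (by norm_num)).mul_left 4
  refine ⟨1 + ∑' n : ℕ, 4 * (n : ℝ) ^ (-(3 / 2) : ℝ), fun N hN => ?_⟩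
  have hN' : (0:ℝ) < N := by exact_mod_cast hN
  have h1 : Real.log N.factorial ≤ ∑ p ∈ N.primesLE, N * (Real.log p / (p - 1)) := by
    rw [log_factorial_eq_sum_primesLE]
    refine Finset.sum_le_sum fun p hp => ?_
    have hpp := (Nat.mem_primesLE.1 hp).2
    have : Fact p.Prime := ⟨hpp⟩
    have hp2 : (2:ℝ) ≤ p := by exact_mod_cast hpp.two_le
    have h2 : (p - 1) * N.factorial.factorization p ≤ N := by
      rw [Nat.factorization_def _ hpp, sub_one_mul_padicValNat_factorial]
      exact Nat.sub_le _ _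
    have h3 : ((p:ℝ) - 1) * N.factorial.factorization p ≤ N := by
      rw [← Nat.cast_one, ← Nat.cast_sub hpp.one_le]; exact_mod_cast h2
    rw [mul_div_assoc', mul_comm (N:ℝ), mul_div_assoc, mul_comm]
    refine mul_le_mul_of_nonneg_left ?_ (Real.log_natCast_nonneg p)
    rw [le_div_iff₀ (by linarith)]; linarith
  have h2 : N * Real.log N - N ≤ Real.log N.factorial := by
    have := Stirling.le_factorial_stirling N
    have h3 : ((N:ℝ) / Real.exp 1) ^ N ≤ N.factorial := by
      refine le_trans (le_mul_of_one_le_left (by positivity) ?_) this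
      rw [Real.one_le_sqrt]
      have : (1:ℝ) ≤ N := by exact_mod_cast hN
      nlinarith [Real.pi_gt_three]
    have h4 := Real.log_le_log (by positivity) h3
    rw [Real.log_pow, Real.log_div hN'.ne' (Real.exp_pos 1).ne', Real.log_exp] at h4
    linarith
  have h3 : ∑ p ∈ N.primesLE, Real.log p / (p - 1)
      ≤ ∑ p ∈ N.primesLE, Real.log p / p + ∑' n : ℕ, 4 * (n : ℝ) ^ (-(3 / 2) : ℝ) := by
    have h4 : ∑ p ∈ N.primesLE, 4 * (p : ℝ) ^ (-(3 / 2) : ℝ)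
        ≤ ∑' n : ℕ, 4 * (n : ℝ) ^ (-(3 / 2) : ℝ) :=
      hsum.sum_le_tsum _ fun _ _ => by positivity
    refine le_trans ?_ (add_le_add_right h4 _)
    rw [← Finset.sum_add_distrib]
    refine Finset.sum_le_sum fun p hp => ?_
    have hp2 : (2:ℝ) ≤ p := by exact_mod_cast (Nat.mem_primesLE.1 hp).2.two_le
    have hp0 : (0:ℝ) < p := by linarith
    have h5 : Real.log p ≤ 2 * (p:ℝ) ^ (1 / 2 : ℝ) := by
      have := Real.log_le_rpow_div hp0.le (show (0:ℝ) < 1 / 2 by norm_num)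
      linarith
    have h6 : Real.log p / (p - 1) = Real.log p / p + Real.log p / (p * (p - 1)) := by
      have : (p:ℝ) - 1 ≠ 0 := by linarith
      field_simp; ring
    have h7 : (p:ℝ) ^ (-(3 / 2) : ℝ) = (p:ℝ) ^ (1 / 2 : ℝ) / p ^ 2 := by
      rw [← Real.rpow_natCast, ← Real.rpow_sub hp0]; norm_num
    rw [h6, h7]
    refine add_le_add_right ?_ _
    rw [mul_div_assoc', div_le_div_iff₀ (by nlinarith) (by positivity)]
    have h8 : 0 ≤ (p:ℝ) ^ (1 / 2 : ℝ) := by positivity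
    have h9 : (p:ℝ) ^ 2 ≤ 2 * (p * (p - 1)) := by nlinarith
    calc Real.log p * (p:ℝ) ^ 2 ≤ (2 * (p:ℝ) ^ (1 / 2 : ℝ)) * (2 * (p * (p - 1))) := by
          gcongr
      _ = _ := by ring
  rw [← Finset.mul_sum] at h1
  have h5 : (N:ℝ) * (Real.log N - 1) ≤ N * ∑ p ∈ N.primesLE, Real.log p / (p - 1) := by linarith
  have h6 := le_of_mul_le_mul_left h5 hN'
  linarith

/-- Mertens' first theorem, on an interval. -/
theorem exists_abs_sum_log_div_sub_le :
    ∃ C : ℝ, 0 < C ∧ ∀ y x : ℝ, 1 ≤ y → y ≤ x →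
      |∑ p ∈ (Finset.Ioc ⌊y⌋₊ ⌊x⌋₊).filter Nat.Prime, Real.log p / p - (Real.log x - Real.log y)|
        ≤ C := by
  obtain ⟨C, hC⟩ := exists_le_sum_log_div
  have hpoint : ∀ x : ℝ, 1 ≤ x →
      |∑ p ∈ ⌊x⌋₊.primesLE, Real.log p / p - Real.log x| ≤ |C| + 1 + Real.log 4 := by
    intro x hx
    have hf : 1 ≤ ⌊x⌋₊ := Nat.le_floor (by simpa using hx)
    have hf' : (1:ℝ) ≤ ⌊x⌋₊ := by exact_mod_cast hf
    have h1 := sum_log_div_le hf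
    have h2 := hC _ hf
    have h3 : Real.log ⌊x⌋₊ ≤ Real.log x :=
      Real.log_le_log (by linarith) (Nat.floor_le (by linarith))
    have h4 : Real.log x ≤ Real.log ⌊x⌋₊ + 1 := by
      have h5 := Nat.lt_floor_add_one x
      have h6 : x ≤ ⌊x⌋₊ * Real.exp 1 := by
        have := Real.add_one_le_exp (1:ℝ)
        nlinarith
      have h7 := Real.log_le_log (by linarith) h6
      rwa [Real.log_mul (by linarith) (Real.exp_pos 1).ne', Real.log_exp] at h7
    have h8 : 0 ≤ Real.log 4 := Real.log_nonneg (by norm_num)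
    rw [abs_le]
    constructor <;> linarith [le_abs_self C, abs_nonneg C]
  have h8 : 0 ≤ Real.log 4 := Real.log_nonneg (by norm_num)
  refine ⟨2 * (|C| + 1 + Real.log 4), by positivity, fun y x hy hyx => ?_⟩
  have hfl : ⌊y⌋₊ ≤ ⌊x⌋₊ := Nat.floor_le_floor hyx
  have hsplit : ∑ p ∈ ⌊x⌋₊.primesLE, Real.log p / p = ∑ p ∈ ⌊y⌋₊.primesLE, Real.log p / p
      + ∑ p ∈ (Finset.Ioc ⌊y⌋₊ ⌊x⌋₊).filter Nat.Prime, Real.log p / p := by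
    rw [← Finset.sum_union]
    · refine Finset.sum_congr ?_ fun _ _ => rfl
      ext p
      simp only [Nat.mem_primesLE, Finset.mem_union, Finset.mem_filter, Finset.mem_Ioc]
      constructor
      · rintro ⟨h1, h2⟩
        by_cases h : p ≤ ⌊y⌋₊
        · exact Or.inl ⟨h, h2⟩
        · exact Or.inr ⟨⟨by omega, h1⟩, h2⟩
      · rintro (⟨h1, h2⟩ | ⟨⟨-, h1⟩, h2⟩)
        · exact ⟨h1.trans hfl, h2⟩
        · exact ⟨h1, h2⟩
    · rw [Finset.disjoint_left]
      intro p hp hp'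
      simp only [Nat.mem_primesLE, Finset.mem_filter, Finset.mem_Ioc] at hp hp'
      omega
  have h1 := abs_le.1 (hpoint x (hy.trans hyx))
  have h2 := abs_le.1 (hpoint y hy)
  rw [abs_le]
  constructor <;> linarith [h1.1, h1.2, h2.1, h2.2]

theorem one_le_Pplus (n : ℕ) : 1 ≤ Pplus n := le_max_left _ _

theorem le_Pplus {p n : ℕ} (hp : p.Prime) (hn : n ≠ 0) (h : p ∣ n) : p ≤ Pplus n :=
  (Finset.le_sup (f := id) (Nat.mem_primeFactors.2 ⟨hp, h, hn⟩)).trans (le_max_right _ _)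

theorem Pplus_le {n k : ℕ} (hk : 1 ≤ k) (h : ∀ p, p.Prime → p ∣ n → p ≤ k) : Pplus n ≤ k :=
  max_le hk (Finset.sup_le fun p hp =>
    h p (Nat.prime_of_mem_primeFactors hp) (Nat.dvd_of_mem_primeFactors hp))

theorem Pplus_one : Pplus 1 = 1 := by simp [Pplus]

theorem Pplus_le_of_dvd {m n : ℕ} (hn : n ≠ 0) (h : m ∣ n) : Pplus m ≤ Pplus n :=
  Pplus_le (one_le_Pplus n) fun _ hp hpm => le_Pplus hp hn (hpm.trans h)

theorem Pplus_mul_le {m n k : ℕ} (hm : m ≠ 0) (hn : n ≠ 0) (hmk : Pplus m ≤ k) (hnk : Pplus n ≤ k) :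
    Pplus (m * n) ≤ k :=
  Pplus_le ((one_le_Pplus m).trans hmk) fun _ hp hpm =>
    (hp.dvd_mul.1 hpm).elim (fun h => (le_Pplus hp hm h).trans hmk)
      fun h => (le_Pplus hp hn h).trans hnk

theorem Pplus_mem_primeFactors {n : ℕ} (hn : 2 ≤ n) : Pplus n ∈ n.primeFactors := by
  have hne : n.primeFactors.Nonempty := Nat.nonempty_primeFactors.2 hn
  obtain ⟨p, hp, hps⟩ := Finset.exists_mem_eq_sup _ hne id
  have h1 : 1 ≤ n.primeFactors.sup id := by
    rw [hps]; exact (Nat.prime_of_mem_primeFactors hp).one_le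
  rw [Pplus, max_eq_right h1, hps]
  exact hp

theorem Pplus_le_self {n : ℕ} (hn : 1 ≤ n) : Pplus n ≤ n :=
  Pplus_le hn fun _ _ h => Nat.le_of_dvd hn h

/-- `m` splits as `m₁ * m₂`, where `m₁` is the product of the smallest primes of `m`, stopped as
soon as it reaches `z`. -/
structure IsHeadTail (z m₁ m₂ : ℕ) : Prop where
  le_head : z ≤ m₁
  head_lt : m₁ < z * Pplus m₁
  le_tail : ∀ r, r.Prime → r ∣ m₂ → Pplus m₁ ≤ r

theorem exists_isHeadTail {z : ℕ} (hz : 2 ≤ z) (m : ℕ) (hm : z ≤ m) :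
    ∃ m₁ m₂, m = m₁ * m₂ ∧ IsHeadTail z m₁ m₂ := by
  induction m using Nat.strong_induction_on with
  | _ m ih =>
    have hmem := Pplus_mem_primeFactors (hz.trans hm)
    have hp := Nat.prime_of_mem_primeFactors hmem
    obtain ⟨m', hm'⟩ := Nat.dvd_of_mem_primeFactors hmem
    set p := Pplus m with hpdef
    have hm0 : 0 < m := by omega
    have hm'0 : 0 < m' := Nat.pos_of_ne_zero fun h => by simp [h] at hm'; omega
    by_cases hlt : m' < z
    · refine ⟨m, 1, by simp, hm, ?_, fun r hr h => ?_⟩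
      · rw [← hpdef]
        calc m = m' * p := by rw [mul_comm]; exact hm'
          _ < z * p := Nat.mul_lt_mul_of_pos_right hlt hp.pos
      · exact absurd (Nat.dvd_one.1 h) hr.ne_one
    · have hlt' : m' < m := by
        rw [hm']; exact lt_mul_left hm'0 hp.one_lt
      obtain ⟨m₁, m₂, h, hht⟩ := ih m' hlt' (by omega)
      refine ⟨m₁, m₂ * p, by rw [hm', h]; ring, hht.le_head, hht.head_lt, fun r hr hrd => ?_⟩
      rcases hr.dvd_mul.1 hrd with h1 | h1
      · exact hht.le_tail r hr h1
      · rw [(Nat.prime_dvd_prime_iff_eq hr hp).1 h1]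
        refine Pplus_le_of_dvd hm0.ne' ?_
        rw [hm', h]
        exact ⟨p * m₂, by ring⟩

theorem IsHeadTail.not_Pplus_dvd {z m₁ m₂ c : ℕ} (h : IsHeadTail z (m₁ * c) m₂) (hz : z ≤ m₁)
    (hc : Pplus (m₁ * c) ∣ c) (hc0 : c ≠ 0) : False := by
  have h1 : m₁ * Pplus (m₁ * c) ≤ m₁ * c :=
    Nat.mul_le_mul_left _ (Nat.le_of_dvd (Nat.pos_of_ne_zero hc0) hc)
  have h2 : m₁ * Pplus (m₁ * c) < z * Pplus (m₁ * c) := h1.trans_lt h.head_lt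
  exact absurd (Nat.lt_of_mul_lt_mul_right h2) (by omega)

theorem IsHeadTail.not_Pplus_lt {z m₁ m₂ n₁ n₂ : ℕ} (hz : 2 ≤ z) (h : IsHeadTail z m₁ m₂)
    (h' : IsHeadTail z n₁ n₂) (he : m₁ * m₂ = n₁ * n₂) : ¬ Pplus m₁ < Pplus n₁ := by
  intro hlt
  have hm0 : m₁ ≠ 0 := by have := h.le_head; omega
  have hn2 : 2 ≤ n₁ := hz.trans h'.le_head
  have hcop : Nat.Coprime m₁ n₂ := Nat.coprime_of_dvd fun r hr h1 h2 => by
    have := le_Pplus hr hm0 h1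
    have := h'.le_tail r hr h2
    omega
  obtain ⟨c, rfl⟩ : m₁ ∣ n₁ := hcop.dvd_of_dvd_mul_right ⟨m₂, he.symm⟩
  have hmem := Pplus_mem_primeFactors hn2
  have hp := Nat.prime_of_mem_primeFactors hmem
  have hc0 : c ≠ 0 := by rintro rfl; simp at hn2
  rcases hp.dvd_mul.1 (Nat.dvd_of_mem_primeFactors hmem) with h1 | h1
  · exact absurd (le_Pplus hp hm0 h1) (by omega)
  · exact h'.not_Pplus_dvd h.le_head h1 hc0

theorem IsHeadTail.head_eq {z m₁ m₂ n₁ n₂ : ℕ} (hz : 2 ≤ z) (h : IsHeadTail z m₁ m₂)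
    (h' : IsHeadTail z n₁ n₂) (he : m₁ * m₂ = n₁ * n₂) : m₁ = n₁ := by
  have hpe : Pplus m₁ = Pplus n₁ :=
    le_antisymm (not_lt.1 (h'.not_Pplus_lt hz h he.symm)) (not_lt.1 (h.not_Pplus_lt hz h' he))
  have hm2 : 2 ≤ m₁ := hz.trans h.le_head
  have hn2 : 2 ≤ n₁ := hz.trans h'.le_head
  have hp := Nat.prime_of_mem_primeFactors (Pplus_mem_primeFactors hm2)
  obtain ⟨p, hpdef⟩ : ∃ p, p = Pplus m₁ := ⟨_, rfl⟩
  rw [← hpdef] at hp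
  obtain ⟨i, k, hk, hik⟩ := Nat.exists_eq_pow_mul_and_not_dvd (n := m₁) (by omega) p hp.ne_one
  obtain ⟨j, l, hl, hjl⟩ := Nat.exists_eq_pow_mul_and_not_dvd (n := n₁) (by omega) p hp.ne_one
  have key : ∀ {i j k l m₁ m₂ n₁ n₂ : ℕ}, 2 ≤ m₁ → p = Pplus m₁ → p = Pplus n₁ →
      IsHeadTail z n₁ n₂ → m₁ * m₂ = n₁ * n₂ → ¬ p ∣ k → m₁ = p ^ i * k → n₁ = p ^ j * l →
      k ∣ l := by
    intro i j k l m₁ m₂ n₁ n₂ hm2 hpm hpn h' he hk hik hjl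
    have hcop : Nat.Coprime k n₂ := Nat.coprime_of_dvd fun r hr h1 h2 => by
      have h3 := le_Pplus hr (by omega : m₁ ≠ 0) (hik ▸ h1.mul_left _)
      have h4 := h'.le_tail r hr h2
      exact hk ((by omega : r = p) ▸ h1)
    have hcop' : Nat.Coprime k (p ^ j) :=
      (Nat.Coprime.pow_left j ((Nat.Prime.coprime_iff_not_dvd hp).2 hk)).symm
    have h1 : k ∣ n₁ := hcop.dvd_of_dvd_mul_right (he ▸ (hik ▸ (Dvd.intro_left _ rfl)).mul_right _)
    rw [hjl] at h1
    exact hcop'.dvd_of_dvd_mul_left h1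
  have hkl : k = l := Nat.dvd_antisymm
    (key hm2 hpdef (hpdef.trans hpe) h' he hk hik hjl)
    (key hn2 (hpdef.trans hpe) hpdef h he.symm hl hjl hik)
  subst hkl
  have final : ∀ {i j m₁ m₂ n₁ n₂ : ℕ}, IsHeadTail z m₁ m₂ → IsHeadTail z n₁ n₂ →
      p = Pplus n₁ → m₁ = p ^ i * k → n₁ = p ^ j * k → ¬ i < j := by
    intro i j m₁ m₂ n₁ n₂ h h' hpn hik hjl hij
    have hn : n₁ = m₁ * p ^ (j - i) := by
      rw [hjl, hik, mul_right_comm, ← pow_add, Nat.add_sub_cancel' hij.le]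
    subst hn
    refine h'.not_Pplus_dvd h.le_head ?_ (pow_ne_zero _ hp.ne_zero)
    rw [← hpn]
    exact dvd_pow_self p (by omega)
  have hij : i = j := by
    have h1 := final h h' (hpdef.trans hpe) hik hjl
    have h2 := final h' h hpdef hjl hik
    omega
  rw [hik, hjl, hij]

theorem Psi_eq_card (x z : ℝ) :
    Psi x z = ((Finset.Icc 1 ⌊x⌋₊).filter (fun n : ℕ => (Pplus n : ℝ) ≤ z)).card := by
  rw [Psi, ← Set.ncard_coe_finset]
  congr 1
  ext n
  simp only [Set.mem_ofPred_eq, Finset.coe_filter, Finset.mem_Icc]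
  constructor
  · rintro ⟨h1, h2, h3⟩
    exact ⟨⟨h1, Nat.le_floor h2⟩, h3⟩
  · rintro ⟨⟨h1, h2⟩, h3⟩
    exact ⟨h1, (Nat.le_floor_iff' (by omega)).1 h2, h3⟩

theorem Psi_mono_right (x : ℝ) {y z : ℝ} (h : y ≤ z) : Psi x y ≤ Psi x z := by
  rw [Psi_eq_card, Psi_eq_card]
  exact Finset.card_le_card (Finset.monotone_filter_right _ fun _ _ hn => hn.trans h)

theorem choose_primeCounting_le_Psi {x y : ℝ} (hy : 1 ≤ y) (k : ℕ) (hk : y ^ k ≤ x) :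
    (Nat.primeCounting ⌊y⌋₊).choose k ≤ Psi x y := by
  rw [← Nat.primesLE_card_eq_primeCounting, ← Finset.card_powersetCard, Psi_eq_card]
  have hprime : ∀ s ∈ (Nat.primesLE ⌊y⌋₊).powersetCard k, ∀ p ∈ s, p.Prime ∧ (p : ℝ) ≤ y := by
    intro s hs p hp
    have h := Nat.mem_primesLE.1 ((Finset.mem_powersetCard.1 hs).1 hp)
    exact ⟨h.2, (Nat.le_floor_iff (by linarith)).1 h.1⟩
  refine Finset.card_le_card_of_injOn (fun s => ∏ p ∈ s, p) (fun s hs => ?_) ?_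
  · have hs' := hprime s hs
    simp only [Finset.coe_filter, Set.mem_ofPred_eq, Finset.mem_Icc]
    refine ⟨⟨Finset.prod_pos fun p hp => (hs' p hp).1.pos, Nat.le_floor ?_⟩, ?_⟩
    · push_cast
      calc ∏ p ∈ s, (p : ℝ) ≤ ∏ _p ∈ s, y :=
            Finset.prod_le_prod (fun _ _ => Nat.cast_nonneg _) fun p hp => (hs' p hp).2
        _ = y ^ k := by rw [Finset.prod_const, (Finset.mem_powersetCard.1 hs).2]
        _ ≤ x := hk
    · rw [← Nat.le_floor_iff (by linarith)]
      refine Pplus_le (Nat.le_floor (by simpa using hy)) fun p hp hpd => ?_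
      obtain ⟨r, hr, hpr⟩ := (hp.prime.dvd_finsetProd_iff _).1 hpd
      rw [(Nat.prime_dvd_prime_iff_eq hp (hs' r hr).1).1 hpr]
      exact Nat.le_floor (hs' r hr).2
  · intro s hs t ht hst
    simp only at hst
    rw [← Nat.primeFactors_prod fun p hp => (hprime s hs p hp).1, hst,
      Nat.primeFactors_prod fun p hp => (hprime t ht p hp).1]

theorem pow_le_choose_of_two_mul_le {n k : ℕ} (hk : 0 < k) {b : ℝ}
    (h : 2 * k * b ≤ n) (h1 : 1 ≤ b) : b ^ k ≤ (n.choose k : ℝ) := by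
  have hk' : (0 : ℝ) < k := Nat.cast_pos.2 hk
  have hkn : 2 * k ≤ n := by
    have : (2 * k : ℝ) ≤ n := by nlinarith
    exact_mod_cast this
  have h2 : (k : ℝ) * b ≤ ((n + 1 - k : ℕ) : ℝ) := by
    rw [Nat.cast_sub (by omega)]
    push_cast
    have : (2 * k : ℝ) ≤ n := by exact_mod_cast hkn
    linarith
  calc b ^ k = (k * b) ^ k / (k : ℝ) ^ k := by
        rw [mul_pow, mul_div_cancel_left₀]; positivity
    _ ≤ ((n + 1 - k : ℕ) : ℝ) ^ k / (k.factorial : ℝ) := by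
        gcongr
        exact_mod_cast Nat.factorial_le_pow k
    _ ≤ _ := by exact_mod_cast Nat.pow_le_choose k n

theorem half_div_log_le_primeCounting {y : ℝ} (hy : 20 ≤ y) :
    y / 2 / Real.log y ≤ Nat.primeCounting ⌊y⌋₊ := by
  have hlog : 0 < Real.log y := Real.log_pos (by linarith)
  refine le_trans ?_ (Chebyshev.pi_ge' (by linarith))
  gcongr
  have h1 : Real.log ((y + 2) / 16) ≤ (y + 2) / 16 - 1 :=
    Real.log_le_sub_one_of_pos (by linarith)
  rw [Real.log_div (by linarith) (by norm_num), show (16 : ℝ) = 2 ^ 4 by norm_num,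
    Real.log_pow] at h1
  have h2 := Real.log_two_gt_d9
  have h3 := Real.log_two_lt_d9
  push_cast at h1
  nlinarith

theorem rpow_le_Psi {τ x w : ℝ} (hτ : 0 < τ) (hτ1 : τ ≤ 1) (hx0 : 0 < x) (hx : 5 ≤ Real.log x)
    (hw : 2 / τ ≤ w) (hy : 4 * Real.log x ≤ (x ^ (1 / w)) ^ (τ / 4)) :
    x ^ (1 - τ) ≤ Psi x (x ^ (1 / w)) := by
  have hw0 : 2 ≤ w := by
    refine le_trans ?_ hw
    rw [le_div_iff₀ hτ]; linarith
  set y := x ^ (1 / w) with hydef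
  have hy0 : 0 < y := Real.rpow_pos_of_pos hx0 _
  have hlogy : w * Real.log y = Real.log x := by
    rw [hydef, Real.log_rpow hx0]; field_simp
  have hy1 : 1 ≤ y := by
    have : 0 ≤ Real.log y := by nlinarith
    exact (Real.log_nonneg_iff hy0).1 this
  have hy20 : 20 ≤ y := by
    calc (20 : ℝ) ≤ 4 * Real.log x := by linarith
      _ ≤ y ^ (τ / 4) := hy
      _ ≤ y ^ (1 : ℝ) := Real.rpow_le_rpow_of_exponent_le hy1 (by linarith)
      _ = y := Real.rpow_one y
  have hlogy0 : 0 < Real.log y := Real.log_pos (by linarith)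
  set k := ⌊w⌋₊ with hk
  have hk1 : (k : ℝ) ≤ w := Nat.floor_le (by linarith)
  have hk2 : w < k + 1 := Nat.lt_floor_add_one w
  have hk0 : 0 < k := Nat.floor_pos.2 (by linarith)
  have hpow : y ^ k ≤ x := by
    rw [← Real.rpow_natCast, hydef, ← Real.rpow_mul hx0.le]
    have hx1 : 1 ≤ x := by
      have : 0 ≤ Real.log x := by linarith
      exact (Real.log_nonneg_iff hx0).1 this
    calc x ^ (1 / w * k) ≤ x ^ (1 : ℝ) := by
          refine Real.rpow_le_rpow_of_exponent_le hx1 ?_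
          rw [one_div_mul_eq_div, div_le_one (by linarith)]; exact hk1
      _ = x := Real.rpow_one x
  have hb : 2 * k * y ^ (1 - τ / 4) ≤ Nat.primeCounting ⌊y⌋₊ := by
    refine le_trans ?_ (half_div_log_le_primeCounting hy20)
    rw [le_div_iff₀ hlogy0]
    have h1 : y ^ (1 - τ / 4) * y ^ (τ / 4) = y := by
      rw [← Real.rpow_add hy0]; simp
    have h2 : k * Real.log y ≤ Real.log x := by
      rw [← hlogy]; gcongr
    have h3 : 0 < y ^ (1 - τ / 4) := Real.rpow_pos_of_pos hy0 _
    calc 2 * k * y ^ (1 - τ / 4) * Real.log y = y ^ (1 - τ / 4) * (2 * (k * Real.log y)) := by ring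
      _ ≤ y ^ (1 - τ / 4) * (y ^ (τ / 4) / 2) := by gcongr; linarith
      _ = y / 2 := by rw [← mul_div_assoc, h1]
  have hfin := pow_le_choose_of_two_mul_le hk0 hb
    (Real.one_le_rpow hy1 (by linarith))
  refine le_trans (le_trans ?_ hfin) (Nat.cast_le.2 (choose_primeCounting_le_Psi hy1 k hpow))
  rw [← Real.rpow_natCast, ← Real.rpow_mul hy0.le, hydef, ← Real.rpow_mul hx0.le]
  refine Real.rpow_le_rpow_of_exponent_le ((Real.log_nonneg_iff hx0).1 (by linarith)) ?_
  have h4 : 1 - τ / 2 ≤ 1 / w * k := by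
    rw [one_div_mul_eq_div, le_div_iff₀ (by linarith)]
    rw [div_le_iff₀ hτ] at hw
    nlinarith
  calc 1 - τ ≤ (1 - τ / 2) * (1 - τ / 4) := by nlinarith
    _ ≤ (1 / w * k) * (1 - τ / 4) := by gcongr; linarith
    _ = _ := by ring

theorem eventually_rpow_le_Psi {τ : ℝ} (hτ : 0 < τ) (hτ1 : τ ≤ 1) :
    ∀ᶠ x : ℝ in Filter.atTop, ∀ v : ℝ, 1 ≤ v →
      v ≤ τ / 8 * Real.log x / Real.log (Real.log x) → x ^ (1 - τ) ≤ Psi x (x ^ (1 / v)) := by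
  have hlim : ∀ᶠ t : ℝ in Filter.atTop, Real.log t ≤ τ ^ 2 / 16 * t := by
    have h := (isLittleO_log_rpow_atTop (r := 1) one_pos).def (c := τ ^ 2 / 16) (by positivity)
    filter_upwards [h, Filter.eventually_ge_atTop 1] with t ht ht1
    rw [Real.rpow_one, Real.norm_of_nonneg (Real.log_nonneg ht1),
      Real.norm_of_nonneg (by linarith)] at ht
    exact ht
  filter_upwards [Filter.eventually_gt_atTop 0, Real.tendsto_log_atTop.eventually hlim,
    Real.tendsto_log_atTop.eventually_ge_atTop 5] with x hx0 hx1 hx5 v hv1 hv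
  have hll : 0 < Real.log (Real.log x) := Real.log_pos (by linarith)
  have hlog4 : Real.log 4 ≤ Real.log (Real.log x) := Real.log_le_log (by norm_num) (by linarith)
  set w := max v (2 / τ) with hw
  have hwle : w ≤ τ / 8 * Real.log x / Real.log (Real.log x) := by
    refine max_le hv ?_
    rw [le_div_iff₀ hll, div_mul_eq_mul_div, div_le_iff₀ hτ]
    nlinarith
  have hw0 : 0 < w := lt_of_lt_of_le (by linarith) (le_max_left _ _)
  have hx1 : 1 ≤ x := (Real.log_nonneg_iff hx0).1 (by linarith)
  refine (rpow_le_Psi hτ hτ1 hx0 hx5 (le_max_right v _) ?_).trans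
    (Nat.cast_le.2 (Psi_mono_right x (Real.rpow_le_rpow_of_exponent_le hx1 ?_)))
  · rw [← Real.rpow_mul hx0.le, ← Real.log_le_log_iff (by linarith) (by positivity),
      Real.log_rpow hx0, Real.log_mul (by norm_num) (by linarith)]
    rw [le_div_iff₀ hll] at hwle
    rw [← hw, one_div_mul_eq_div, div_mul_eq_mul_div, le_div_iff₀ hw0]
    nlinarith
  · exact one_div_le_one_div_of_le (by linarith) (le_max_left _ _)

theorem card_filter_lt_Pplus_le {w : ℝ} (hw : 1 ≤ w) (X : ℕ) :
    (((Finset.Icc 1 X).filter (fun m : ℕ => w < (Pplus m : ℝ))).card : ℝ) ≤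
      ∑ p ∈ (Finset.Ioc ⌊w⌋₊ X).filter Nat.Prime, (X : ℝ) / p := by
  have hsub : (Finset.Icc 1 X).filter (fun m : ℕ => w < (Pplus m : ℝ)) ⊆
      ((Finset.Ioc ⌊w⌋₊ X).filter Nat.Prime).biUnion
        fun p => (Finset.Ioc 0 X).filter (fun m => p ∣ m) := by
    intro m hm
    simp only [Finset.mem_filter, Finset.mem_Icc] at hm
    obtain ⟨⟨hm1, hmX⟩, hmw⟩ := hm
    have hm2 : 2 ≤ m := by
      by_contra! h
      have : m = 1 := by omega
      rw [this, Pplus_one] at hmw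
      norm_num at hmw
      linarith
    have hmem := Pplus_mem_primeFactors hm2
    simp only [Finset.mem_biUnion, Finset.mem_filter, Finset.mem_Ioc]
    exact ⟨Pplus m, ⟨⟨(Nat.floor_lt (by linarith)).2 hmw, (Pplus_le_self hm1).trans hmX⟩,
      Nat.prime_of_mem_primeFactors hmem⟩, ⟨hm1, hmX⟩, Nat.dvd_of_mem_primeFactors hmem⟩
  have hcard := (Finset.card_le_card hsub).trans Finset.card_biUnion_le
  refine (Nat.cast_le.2 hcard).trans ?_
  push_cast
  refine Finset.sum_le_sum fun p _ => ?_
  convert Nat.cast_div_le (α := ℝ) (m := X) (n := p) using 2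
  rw [← Nat.Ioc_filter_dvd_card_eq_div]

theorem eventually_card_filter_lt_Pplus_le {τ : ℝ} (hτ : 0 < τ) (hτ1 : τ ≤ 1 / 100) :
    ∀ᶠ x : ℝ in Filter.atTop,
      (((Finset.Icc 1 ⌊x⌋₊).filter (fun m : ℕ => x ^ (1 - 2 * τ) < (Pplus m : ℝ))).card : ℝ) ≤
        4 * τ * x := by
  obtain ⟨C, -, hC⟩ := exists_abs_sum_log_div_sub_le
  filter_upwards [Filter.eventually_gt_atTop 1,
    Real.tendsto_log_atTop.eventually_ge_atTop (C / τ)] with x hx1 hxC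
  have hx0 : 0 < x := by linarith
  have hlog : 0 < Real.log x := Real.log_pos hx1
  rw [div_le_iff₀ hτ] at hxC
  set w := x ^ (1 - 2 * τ) with hw
  have hw1 : 1 ≤ w := Real.one_le_rpow hx1.le (by linarith)
  have hwx : w ≤ x := by
    calc w ≤ x ^ (1 : ℝ) := Real.rpow_le_rpow_of_exponent_le hx1.le (by linarith)
      _ = x := Real.rpow_one x
  have hlogw : Real.log w = (1 - 2 * τ) * Real.log x := Real.log_rpow hx0 _
  have hlogw0 : 0 < Real.log w := by rw [hlogw]; exact mul_pos (by linarith) hlog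
  refine (card_filter_lt_Pplus_le hw1 ⌊x⌋₊).trans ?_
  have hterm : ∀ p ∈ (Finset.Ioc ⌊w⌋₊ ⌊x⌋₊).filter Nat.Prime,
      (⌊x⌋₊ : ℝ) / p ≤ x / Real.log w * (Real.log p / p) := by
    intro p hp
    simp only [Finset.mem_filter, Finset.mem_Ioc] at hp
    have hp0 : (0 : ℝ) < p := Nat.cast_pos.2 hp.2.pos
    have hwp : Real.log w ≤ Real.log p :=
      Real.log_le_log (by linarith) ((Nat.lt_of_floor_lt hp.1.1).le)
    calc (⌊x⌋₊ : ℝ) / p ≤ x / p := by gcongr; exact Nat.floor_le hx0.le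
      _ ≤ x / p * (Real.log p / Real.log w) :=
          le_mul_of_one_le_right (by positivity) ((one_le_div hlogw0).2 hwp)
      _ = _ := by ring
  refine (Finset.sum_le_sum hterm).trans ?_
  rw [← Finset.mul_sum]
  have h := (abs_le.1 (hC w x hw1 hwx)).2
  calc x / Real.log w * _ ≤ x / Real.log w * (3 * τ * Real.log x) := by
        gcongr
        rw [hlogw] at h
        linarith
    _ ≤ 4 * τ * x := by
        rw [div_mul_eq_mul_div, div_le_iff₀ hlogw0, hlogw]
        have : 0 < τ * x * Real.log x := by positivity
        nlinarith

theorem eventually_mul_Psi_le_card {τ : ℝ} (hτ : 0 < τ) (hτ1 : τ ≤ 1 / 100) :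
    ∀ᶠ x : ℝ in Filter.atTop, ∀ y : ℝ, (1 - 8 * τ) * Psi x y ≤
      (((Finset.Icc 1 ⌊x⌋₊).filter
        (fun m : ℕ => (Pplus m : ℝ) ≤ y ∧ (Pplus m : ℝ) ≤ x ^ (1 - 2 * τ))).card : ℝ) := by
  filter_upwards [eventually_card_filter_lt_Pplus_le hτ hτ1,
    Filter.eventually_ge_atTop 10] with x hx hx10 y
  rw [Psi_eq_card]
  set w := x ^ (1 - 2 * τ)
  set s := Finset.Icc 1 ⌊x⌋₊ with hs
  rcases le_or_gt y w with hyw | hyw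
  · have : s.filter (fun m : ℕ => (Pplus m : ℝ) ≤ y ∧ (Pplus m : ℝ) ≤ w) =
        s.filter (fun m : ℕ => (Pplus m : ℝ) ≤ y) :=
      Finset.filter_congr fun m _ => ⟨fun h => h.1, fun h => ⟨h, h.trans hyw⟩⟩
    rw [this]
    have : (0 : ℝ) ≤ ((s.filter (fun m : ℕ => (Pplus m : ℝ) ≤ y)).card : ℝ) := Nat.cast_nonneg _
    nlinarith
  · have h1 : s.filter (fun m : ℕ => (Pplus m : ℝ) ≤ y ∧ (Pplus m : ℝ) ≤ w) =
        s.filter (fun m : ℕ => (Pplus m : ℝ) ≤ w) :=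
      Finset.filter_congr fun m _ => ⟨fun h => h.2, fun h => ⟨h.trans hyw.le, h⟩⟩
    have h2 : ((s.filter (fun m : ℕ => (Pplus m : ℝ) ≤ w)).card : ℝ) +
        ((s.filter (fun m : ℕ => w < (Pplus m : ℝ))).card : ℝ) = s.card := by
      rw [← Nat.cast_add, ← Finset.card_filter_add_card_filter_not (s := s)
        (fun m : ℕ => (Pplus m : ℝ) ≤ w)]
      simp only [not_le]
    have h3 : ((s.filter (fun m : ℕ => (Pplus m : ℝ) ≤ y)).card : ℝ) ≤ s.card :=
      Nat.cast_le.2 (Finset.card_filter_le _ _)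
    have h4 : x - 1 ≤ (s.card : ℝ) := by
      rw [hs, Nat.card_Icc, Nat.add_sub_cancel]
      linarith [Nat.lt_floor_add_one x]
    have h5 : (s.card : ℝ) ≤ x := by
      rw [hs, Nat.card_Icc, Nat.add_sub_cancel]
      exact Nat.floor_le (by linarith)
    rw [h1]
    calc _ ≤ (1 - 8 * τ) * (s.card : ℝ) := by gcongr; linarith
      _ ≤ _ := by nlinarith

/-- Size conditions under which the dyadic bilinear sums are `O(K ^ 4 * √(W * X))`. -/
structure DyadicRange (X z B Q₀ Q₁ K : ℕ) (W : ℝ) : Prop where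
  one_le_W : 1 ≤ W
  B_le_X : B ≤ X
  z_pos : 0 < z
  Q₁_le_X : Q₁ ≤ X
  X_le_two_pow : 2 * X + 2 ≤ 2 ^ K
  X_le_mul_sq : (X : ℝ) ≤ W * (Q₀ : ℝ) ^ 2
  B_le_W : (B : ℝ) ≤ W
  X_le_mul : (X : ℝ) ≤ W * z
  sq_le_W : (Q₁ : ℝ) ^ 2 ≤ W

theorem DyadicRange.large_sieve_const_le {X z B Q₀ Q₁ K : ℕ} {W : ℝ}
    (hR : DyadicRange X z B Q₀ Q₁ K W) {j k m q : ℕ} (hm : z ≤ m) (hmB : m ≤ B)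
    (hmj : 2 ^ j ≤ m) (hmj' : m < 2 ^ (j + 1)) (hq₀ : Q₀ ≤ q) (hq₁ : q ≤ Q₁) (hqk : 2 ^ k ≤ q)
    (hqk' : q < 2 ^ (k + 1)) :
    Real.log (2 ^ (k + 1) : ℕ) / (2 ^ k : ℕ) *
      (√((2 ^ (j + 1) : ℕ) + ((2 ^ (k + 1)) ^ 2 : ℕ) * (1 + Real.log ((2 ^ (k + 1)) ^ 2 : ℕ))) *
        √((X / 2 ^ j + 1 : ℕ) + ((2 ^ (k + 1)) ^ 2 : ℕ) * (1 + Real.log ((2 ^ (k + 1)) ^ 2 : ℕ))))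
      ≤ 24 * K ^ 2 * √W := by
  obtain ⟨hW, hBX, hz, hQX, hK, hXQ, hBW, hXz, hQW⟩ := hR
  have hkK : k + 1 ≤ K := by
    have : 2 ^ (k + 1) ≤ 2 ^ K := by rw [pow_succ]; omega
    exact (Nat.pow_le_pow_iff_right (by norm_num)).1 this
  have hkK' : (k : ℝ) + 1 ≤ K := by exact_mod_cast hkK
  have hlog : Real.log (2 ^ (k + 1) : ℕ) = (k + 1) * Real.log 2 := by
    push_cast; rw [Real.log_pow]; push_cast; ring
  have hlog2 := Real.log_two_lt_d9
  have hlog2' := Real.log_two_gt_d9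
  have hk0 : (0 : ℝ) ≤ k := Nat.cast_nonneg _
  have hlogK : Real.log (2 ^ (k + 1) : ℕ) ≤ K := by rw [hlog]; nlinarith
  have hlog0 : 0 ≤ Real.log (2 ^ (k + 1) : ℕ) := by rw [hlog]; positivity
  have hlogsq : Real.log ((2 ^ (k + 1)) ^ 2 : ℕ) = 2 * ((k + 1) * Real.log 2) := by
    rw [← hlog]; push_cast; rw [Real.log_pow]; push_cast; ring
  obtain ⟨H, hH⟩ : ∃ H, H = 1 + Real.log ((2 ^ (k + 1)) ^ 2 : ℕ) := ⟨_, rfl⟩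
  have hH1 : 1 ≤ H := by rw [hH, hlogsq]; nlinarith
  have hHK : H ≤ 3 * K := by rw [hH, hlogsq]; nlinarith
  rw [← hH]
  obtain ⟨Q, hQ⟩ : ∃ Q : ℝ, Q = 2 ^ k := ⟨_, rfl⟩
  obtain ⟨J, hJ⟩ : ∃ J : ℝ, J = 2 ^ j := ⟨_, rfl⟩
  have hQ1 : 0 < Q := by rw [hQ]; positivity
  have hJ1 : 0 < J := by rw [hJ]; positivity
  have hQ₁ : Q ≤ Q₁ := by rw [hQ]; exact_mod_cast hqk.trans hq₁
  have hQ₀ : (Q₀ : ℝ) ≤ 2 * Q := by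
    rw [hQ, ← pow_succ']; exact_mod_cast hq₀.trans hqk'.le
  have hJB : J ≤ B := by rw [hJ]; exact_mod_cast hmj.trans hmB
  have hJX : J ≤ X := hJB.trans (by exact_mod_cast hBX)
  have hJz : (z : ℝ) ≤ 2 * J := by
    rw [hJ, ← pow_succ']; exact_mod_cast hm.trans hmj'.le
  have hXJ : (X : ℝ) / J ≤ 2 * W := by
    rw [div_le_iff₀ hJ1]
    nlinarith
  have hprod : (2 * J + (2 * Q) ^ 2 * H) * (X / J + 1 + (2 * Q) ^ 2 * H) ≤
      (8 * H * Q * √W) ^ 2 := by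
    have h1 : 2 * J * (X / J + 1) ≤ 16 * (W * Q ^ 2) := by
      have : 2 * J * (X / J + 1) = 2 * X + 2 * J := by field_simp
      rw [this]
      have : (Q₀ : ℝ) ^ 2 ≤ (2 * Q) ^ 2 := by gcongr
      nlinarith
    have h2 : 2 * J + (X / J + 1) ≤ 5 * W := by linarith
    have h3 : Q ^ 2 ≤ W := (by gcongr : Q ^ 2 ≤ (Q₁ : ℝ) ^ 2).trans hQW
    have h4 : W * Q ^ 2 ≤ W * Q ^ 2 * H ^ 2 :=
      le_mul_of_one_le_right (by positivity) (one_le_pow₀ hH1)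
    have h5 : Q ^ 2 * H * (2 * J + (X / J + 1)) ≤ Q ^ 2 * H ^ 2 * (5 * W) := by
      gcongr
      nlinarith
    have h6 : Q ^ 2 * Q ^ 2 * H ^ 2 ≤ Q ^ 2 * W * H ^ 2 := by gcongr
    have h7 : (8 * H * Q * √W) ^ 2 = 64 * (W * Q ^ 2 * H ^ 2) := by
      rw [mul_pow, Real.sq_sqrt (by linarith)]; ring
    rw [h7]
    generalize (X : ℝ) / J + 1 = N at *
    calc (2 * J + (2 * Q) ^ 2 * H) * (N + (2 * Q) ^ 2 * H)
        = 2 * J * N + 4 * (Q ^ 2 * H * (2 * J + N)) + 16 * (Q ^ 2 * Q ^ 2 * H ^ 2) := by ring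
      _ ≤ 16 * (W * Q ^ 2 * H ^ 2) + 4 * (Q ^ 2 * H ^ 2 * (5 * W)) +
          16 * (Q ^ 2 * W * H ^ 2) := by linarith
      _ = 52 * (W * Q ^ 2 * H ^ 2) := by ring
      _ ≤ 64 * (W * Q ^ 2 * H ^ 2) := by
          have : 0 ≤ W * Q ^ 2 * H ^ 2 := by positivity
          linarith
  have hsqrt : √((2 ^ (j + 1) : ℕ) + ((2 ^ (k + 1)) ^ 2 : ℕ) * H) *
      √((X / 2 ^ j + 1 : ℕ) + ((2 ^ (k + 1)) ^ 2 : ℕ) * H) ≤ 8 * H * Q * √W := by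
    rw [← Real.sqrt_mul (by positivity)]
    refine Real.sqrt_le_iff.2 ⟨by positivity, le_trans ?_ hprod⟩
    push_cast
    rw [pow_succ' 2 j, pow_succ' 2 k, ← hQ, ← hJ]
    gcongr
    rw [hJ]
    exact_mod_cast Nat.cast_div_le (α := ℝ) (m := X) (n := 2 ^ j)
  have hcast : ((2 ^ k : ℕ) : ℝ) = Q := by rw [hQ]; push_cast; rfl
  rw [hcast]
  calc _ ≤ (K : ℝ) / Q * (8 * H * Q * √W) :=
        mul_le_mul (div_le_div_of_nonneg_right hlogK hQ1.le) hsqrt (by positivity) (by positivity)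
    _ ≤ (K : ℝ) / Q * (8 * (3 * K) * Q * √W) := by gcongr
    _ = 24 * K ^ 2 * √W := by field_simp; ring

theorem DyadicRange.abs_sum_block_le {X z B Q₀ Q₁ K : ℕ} {W : ℝ}
    (hR : DyadicRange X z B Q₀ Q₁ K W) {a j k : ℕ} {S T 𝒬 : Finset ℕ}
    (hS : ∀ m ∈ S, z ≤ m ∧ m ≤ B ∧ 2 ^ j ≤ m ∧ m < 2 ^ (j + 1))
    (hT : ∀ n ∈ T, 1 ≤ n ∧ n ≤ X / 2 ^ j)
    (h𝒬 : ∀ q ∈ 𝒬, q.Prime ∧ Q₀ ≤ q ∧ q ≤ Q₁ ∧ 2 ^ k ≤ q ∧ q < 2 ^ (k + 1) ∧ (a : ZMod q) ≠ 0)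
    {f f' g g' : ℕ → ℕ} (hf : ∀ m ∈ S, f m < 2 ^ K) (hf' : ∀ n ∈ T, f' n < 2 ^ K)
    (hg : ∀ m ∈ S, g m < 2 ^ K) (hg' : ∀ n ∈ T, g' n < 2 ^ K) :
    |∑ m ∈ S, ∑ n ∈ T, if f m < f' n then
        (if g m < g' n then ∑ q ∈ 𝒬, Real.log q * congrKernel a q m n else 0) else 0| ≤
      24 * K ^ 4 * √(W * X) := by
  have hbound0 : 0 ≤ 24 * (K : ℝ) ^ 4 * √(W * X) := by positivity
  rcases S.eq_empty_or_nonempty with rfl | ⟨m, hm⟩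
  · simpa using hbound0
  rcases 𝒬.eq_empty_or_nonempty with rfl | ⟨q, hq⟩
  · simpa using hbound0
  obtain ⟨hm1, hm2, hm3, hm4⟩ := hS m hm
  obtain ⟨-, hq1, hq2, hq3, hq4, -⟩ := h𝒬 q hq
  have hC := hR.large_sieve_const_le hm1 hm2 hm3 hm4 hq1 hq2 hq3 hq4
  have hB := bilinearBound_sum_congrKernel (𝒬 := 𝒬) (Q := 2 ^ k) (P := 2 ^ (k + 1)) (a := a)
    (by positivity) (fun q hq => (h𝒬 q hq).1) (fun q hq => (h𝒬 q hq).2.2.2.1)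
    (fun q hq => (h𝒬 q hq).2.2.2.2.1.le) (fun q hq => (h𝒬 q hq).2.2.2.2.2)
    (M := 2 ^ (j + 1)) (N := X / 2 ^ j + 1) (S := S) (T := T)
    (fun m hm => (hS m hm).2.2.2) (fun n hn => Nat.lt_succ_of_le (hT n hn).2)
  have hC0 : 0 ≤ Real.log (2 ^ (k + 1) : ℕ) / (2 ^ k : ℕ) *
      (√((2 ^ (j + 1) : ℕ) + ((2 ^ (k + 1)) ^ 2 : ℕ) * (1 + Real.log ((2 ^ (k + 1)) ^ 2 : ℕ))) *
        √((X / 2 ^ j + 1 : ℕ) +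
          ((2 ^ (k + 1)) ^ 2 : ℕ) * (1 + Real.log ((2 ^ (k + 1)) ^ 2 : ℕ)))) := by
    have := Real.log_natCast_nonneg (2 ^ (k + 1))
    positivity
  have h := ((hB.ite_lt hC0 K g g' hg hg').ite_lt (by positivity) K f f' hf hf')
    (fun _ => 1) (fun _ => 1)
  simp only [one_mul, one_pow, Finset.sum_const, nsmul_eq_mul, mul_one] at h
  have hScard : (S.card : ℝ) ≤ 2 ^ j := by
    have hsub : S ⊆ Finset.Ico (2 ^ j) (2 ^ (j + 1)) := fun m hm =>
      Finset.mem_Ico.2 ⟨(hS m hm).2.2.1, (hS m hm).2.2.2⟩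
    have := Finset.card_le_card hsub
    rw [Nat.card_Ico, pow_succ, mul_two, Nat.add_sub_cancel] at this
    exact_mod_cast this
  have hTcard : (T.card : ℝ) ≤ X / 2 ^ j := by
    have hsub : T ⊆ Finset.Icc 1 (X / 2 ^ j) := fun n hn => Finset.mem_Icc.2 (hT n hn)
    have := Finset.card_le_card hsub
    rw [Nat.card_Icc, Nat.add_sub_cancel] at this
    refine (Nat.cast_le.2 this).trans ?_
    exact_mod_cast Nat.cast_div_le (α := ℝ) (m := X) (n := 2 ^ j)
  have hcards : √(S.card : ℝ) * √(T.card : ℝ) ≤ √X := by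
    rw [← Real.sqrt_mul (by positivity)]
    refine Real.sqrt_le_sqrt ?_
    calc (S.card : ℝ) * T.card ≤ 2 ^ j * (X / 2 ^ j) := by gcongr
      _ = X := by field_simp
  have hW := hR.one_le_W
  refine h.trans ?_
  rw [mul_assoc, Real.sqrt_mul (by linarith)]
  calc _ ≤ (K : ℝ) * (K * (24 * K ^ 2 * √W)) * √X := by gcongr
    _ = _ := by ring

/-- Pairs `(m₁, m₂)` with `m₁ ≤ B` the head and `m₂` the tail of a `Y`-friable integer up to `X`. -/
noncomputable def headTailPairs (X z B Y : ℕ) : Finset (ℕ × ℕ) :=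
  (Finset.Icc 1 X ×ˢ Finset.Icc 1 X).filter fun p =>
    IsHeadTail z p.1 p.2 ∧ p.1 ≤ B ∧ p.1 * p.2 ≤ X ∧ Pplus p.1 ≤ Y ∧ Pplus p.2 ≤ Y

theorem mem_headTailPairs {X z B Y : ℕ} {p : ℕ × ℕ} :
    p ∈ headTailPairs X z B Y ↔ ((1 ≤ p.1 ∧ p.1 ≤ X) ∧ (1 ≤ p.2 ∧ p.2 ≤ X)) ∧
      IsHeadTail z p.1 p.2 ∧ p.1 ≤ B ∧ p.1 * p.2 ≤ X ∧ Pplus p.1 ≤ Y ∧ Pplus p.2 ≤ Y := by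
  simp only [headTailPairs, Finset.mem_filter, Finset.mem_product, Finset.mem_Icc]

/-- The least prime factor, with value `X` at `1`. -/
noncomputable def minFacOr (X n : ℕ) : ℕ := if n = 1 then X else n.minFac

theorem lt_minFacOr_add_one_iff {X k n : ℕ} (hk : k ≤ X) :
    k < minFacOr X n + 1 ↔ ∀ r, r.Prime → r ∣ n → k ≤ r := by
  rw [Nat.lt_succ_iff, minFacOr]
  split_ifs with h
  · subst h
    exact ⟨fun _ r hr hd => absurd (Nat.dvd_one.1 hd) hr.ne_one, fun _ => hk⟩
  · exact ⟨fun h1 r hr hd => h1.trans (Nat.minFac_le_of_dvd hr.two_le hd),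
      fun h1 => h1 _ (Nat.minFac_prime h) (Nat.minFac_dvd n)⟩

theorem minFacOr_le {X n : ℕ} (hn : 1 ≤ n) (hX : n ≤ X) : minFacOr X n ≤ X := by
  rw [minFacOr]
  split_ifs
  · exact le_rfl
  · exact (Nat.minFac_le hn).trans hX

theorem sum_headTailPairs_filter_log_eq (X z B Y j : ℕ) (F : ℕ → ℕ → ℝ) :
    ∑ p ∈ (headTailPairs X z B Y).filter (fun p => Nat.log 2 p.1 = j), F p.1 p.2 =
      ∑ m ∈ (Finset.Icc 1 X).filter (fun m => z ≤ m ∧ m < z * Pplus m ∧ m ≤ B ∧ Pplus m ≤ Y ∧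
          Nat.log 2 m = j),
        ∑ n ∈ (Finset.Icc 1 (X / 2 ^ j)).filter (fun n => Pplus n ≤ Y),
          if Pplus m < minFacOr X n + 1 then (if m < X / n + 1 then F m n else 0) else 0 := by
  rw [← Finset.sum_product']
  simp only [← ite_and]
  rw [← Finset.sum_filter]
  refine Finset.sum_congr ?_ fun _ _ => rfl
  ext ⟨m, n⟩
  simp only [mem_headTailPairs, Finset.mem_filter, Finset.mem_product, Finset.mem_Icc]
  constructor
  · rintro ⟨⟨⟨⟨h1, h2⟩, h3, h4⟩, h5, h6, h7, h8, h9⟩, h10⟩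
    have h11 : 2 ^ j ≤ m := h10 ▸ Nat.pow_log_le_self 2 (by omega)
    refine ⟨⟨⟨⟨h1, h2⟩, h5.le_head, h5.head_lt, h6, h8, h10⟩, ⟨h3, ?_⟩, h9⟩, ?_, ?_⟩
    · rw [Nat.le_div_iff_mul_le (by positivity), mul_comm]
      exact (Nat.mul_le_mul_right n h11).trans h7
    · exact (lt_minFacOr_add_one_iff ((Pplus_le_self h1).trans h2)).2 h5.le_tail
    · rw [Nat.lt_succ_iff, Nat.le_div_iff_mul_le (by omega)]
      exact h7
  · rintro ⟨⟨⟨⟨h1, h2⟩, h3, h4, h5, h6, h7⟩, ⟨h8, h9⟩, h10⟩, h11, h12⟩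
    rw [Nat.lt_succ_iff, Nat.le_div_iff_mul_le (by omega)] at h12
    exact ⟨⟨⟨⟨h1, h2⟩, h8, h9.trans (Nat.div_le_self _ _)⟩,
      ⟨h3, h4, (lt_minFacOr_add_one_iff ((Pplus_le_self h1).trans h2)).1 h11⟩, h5, h12, h6,
      h10⟩, h7⟩

theorem DyadicRange.abs_sum_headTailPairs_le {X z B Q₀ Q₁ K : ℕ} {W : ℝ}
    (hR : DyadicRange X z B Q₀ Q₁ K W) {a : ℕ} (Y : ℕ) {𝒬 : Finset ℕ}
    (h𝒬 : ∀ q ∈ 𝒬, q.Prime ∧ Q₀ ≤ q ∧ q ≤ Q₁ ∧ (a : ZMod q) ≠ 0) :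
    |∑ p ∈ headTailPairs X z B Y, ∑ q ∈ 𝒬, Real.log q * congrKernel a q p.1 p.2| ≤
      24 * K ^ 6 * √(W * X) := by
  have hlogK : ∀ m, m ≤ X → Nat.log 2 m ∈ Finset.range K := fun m hm =>
    Finset.mem_range.2 (Nat.log_lt_of_lt_pow' (by have := hR.X_le_two_pow; rintro rfl; omega)
      (by have := hR.X_le_two_pow; omega))
  have hsplit : ∑ p ∈ headTailPairs X z B Y, ∑ q ∈ 𝒬, Real.log q * congrKernel a q p.1 p.2 =
      ∑ k ∈ Finset.range K, ∑ j ∈ Finset.range K,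
        ∑ p ∈ (headTailPairs X z B Y).filter (fun p => Nat.log 2 p.1 = j),
          ∑ q ∈ 𝒬.filter (fun q => Nat.log 2 q = k), Real.log q * congrKernel a q p.1 p.2 := by
    have h1 : ∀ k, ∑ j ∈ Finset.range K,
        ∑ p ∈ (headTailPairs X z B Y).filter (fun p => Nat.log 2 p.1 = j),
          ∑ q ∈ 𝒬.filter (fun q => Nat.log 2 q = k), Real.log q * congrKernel a q p.1 p.2 =
        ∑ p ∈ headTailPairs X z B Y,
          ∑ q ∈ 𝒬.filter (fun q => Nat.log 2 q = k), Real.log q * congrKernel a q p.1 p.2 :=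
      fun k => Finset.sum_fiberwise_of_maps_to
        (fun p hp => hlogK _ (mem_headTailPairs.1 hp).1.1.2) _
    simp only [h1]
    rw [Finset.sum_comm (s := Finset.range K)]
    refine Finset.sum_congr rfl fun p _ => ?_
    exact (Finset.sum_fiberwise_of_maps_to
      (fun q hq => hlogK _ ((h𝒬 q hq).2.2.1.trans hR.Q₁_le_X)) _).symm
  have hlog : ∀ {m j}, m ≠ 0 → Nat.log 2 m = j → 2 ^ j ≤ m ∧ m < 2 ^ (j + 1) := by
    rintro m j hm rfl
    exact ⟨Nat.pow_log_le_self 2 hm, Nat.lt_pow_succ_log_self (by norm_num) m⟩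
  have hX := hR.X_le_two_pow
  have hblock : ∀ k ∈ Finset.range K, ∀ j ∈ Finset.range K,
      |∑ p ∈ (headTailPairs X z B Y).filter (fun p => Nat.log 2 p.1 = j),
        ∑ q ∈ 𝒬.filter (fun q => Nat.log 2 q = k), Real.log q * congrKernel a q p.1 p.2| ≤
      24 * K ^ 4 * √(W * X) := by
    intro k _ j _
    rw [sum_headTailPairs_filter_log_eq X z B Y j fun m n =>
      ∑ q ∈ 𝒬.filter (fun q => Nat.log 2 q = k), Real.log q * congrKernel a q m n]
    refine hR.abs_sum_block_le (j := j) (k := k) (fun m hm => ?_) (fun n hn => ?_) (fun q hq => ?_)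
      (fun m hm => ?_) (fun n hn => ?_) (fun m hm => ?_) (fun n hn => ?_)
    · simp only [Finset.mem_filter, Finset.mem_Icc] at hm
      exact ⟨hm.2.1, hm.2.2.2.1, hlog (by omega) hm.2.2.2.2.2⟩
    · simp only [Finset.mem_filter, Finset.mem_Icc] at hn
      exact hn.1
    · simp only [Finset.mem_filter] at hq
      obtain ⟨h1, h2, h3, h4⟩ := h𝒬 q hq.1
      obtain ⟨h5, h6⟩ := hlog h1.ne_zero hq.2
      exact ⟨h1, h2, h3, h5, h6, h4⟩
    · simp only [Finset.mem_filter, Finset.mem_Icc] at hm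
      have := Pplus_le_self hm.1.1
      omega
    · simp only [Finset.mem_filter, Finset.mem_Icc] at hn
      have := minFacOr_le hn.1.1 (hn.1.2.trans (Nat.div_le_self _ _))
      omega
    · simp only [Finset.mem_filter, Finset.mem_Icc] at hm
      omega
    · have := Nat.div_le_self X n
      omega
  rw [hsplit]
  calc _ ≤ ∑ _k ∈ Finset.range K, ∑ _j ∈ Finset.range K, 24 * (K : ℝ) ^ 4 * √(W * X) :=
        (Finset.abs_sum_le_sum_abs _ _).trans (Finset.sum_le_sum fun k hk =>
          (Finset.abs_sum_le_sum_abs _ _).trans (Finset.sum_le_sum fun j hj => hblock k hk j hj))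
    _ = _ := by
        simp only [Finset.sum_const, Finset.card_range, nsmul_eq_mul]
        ring

theorem sum_log_le_of_prime_dvd {s : Finset ℕ} {n : ℕ} (hn : n ≠ 0)
    (hs : ∀ q ∈ s, q.Prime ∧ q ∣ n) : ∑ q ∈ s, Real.log q ≤ Real.log n := by
  rw [← Real.log_prod fun q hq => Nat.cast_ne_zero.2 (hs q hq).1.ne_zero, ← Nat.cast_prod]
  refine Real.log_le_log (Nat.cast_pos.2 (Finset.prod_pos fun q hq => (hs q hq).1.pos))
    (Nat.cast_le.2 (Nat.le_of_dvd (Nat.pos_of_ne_zero hn) ?_))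
  exact Finset.prod_primes_dvd n (fun q hq => (hs q hq).1.prime) fun q hq => (hs q hq).2

theorem sum_log_le_of_prime_dvd_of_lt {𝒬 : Finset ℕ} {n X : ℕ} {R : ℝ} (hn : 1 ≤ n) (hX : n ≤ X)
    (hR : 1 ≤ R) (hq : ∀ q ∈ 𝒬, q.Prime ∧ (q : ℝ) ≤ R) (hP : R < Pplus n) :
    ∑ q ∈ 𝒬.filter (fun q => q ∣ n), Real.log q ≤ Real.log X - Real.log R := by
  have hn2 : 2 ≤ n := by
    by_contra! h
    have : n = 1 := by omega
    rw [this, Pplus_one] at hP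
    norm_num at hP
    linarith
  have hmem := Pplus_mem_primeFactors hn2
  have hnot : Pplus n ∉ 𝒬.filter (fun q => q ∣ n) := fun h =>
    absurd (hq _ (Finset.mem_filter.1 h).1).2 (not_le.2 hP)
  have h := sum_log_le_of_prime_dvd (s := insert (Pplus n) (𝒬.filter (fun q => q ∣ n))) (n := n)
    (by omega) fun q hq' => by
      rcases Finset.mem_insert.1 hq' with rfl | h
      · exact ⟨Nat.prime_of_mem_primeFactors hmem, Nat.dvd_of_mem_primeFactors hmem⟩
      · exact ⟨(hq q (Finset.mem_filter.1 h).1).1, (Finset.mem_filter.1 h).2⟩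
  rw [Finset.sum_insert hnot] at h
  have h1 : Real.log R ≤ Real.log (Pplus n) := Real.log_le_log (by linarith) hP.le
  have h2 : Real.log n ≤ Real.log X := Real.log_le_log (by exact_mod_cast hn) (by exact_mod_cast hX)
  linarith

theorem le_sum_log_of_congrKernel {𝒬 : Finset ℕ} {Q₀ a m n X : ℕ} (hQ₀ : 2 ≤ Q₀)
    (h𝒬 : ∀ q ∈ 𝒬, q.Prime ∧ Q₀ ≤ q) (hm : 1 ≤ m) (hn : 1 ≤ n) (ha : a < m * n)
    (hX : m * n ≤ X) :
    ∑ q ∈ 𝒬, Real.log q / q - Real.log X / (Q₀ - 1) +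
        ∑ q ∈ 𝒬, Real.log q * congrKernel a q m n ≤
      ∑ q ∈ 𝒬.filter (fun q => q ∣ m * n - a), Real.log q := by
  have hmn : m * n ≠ 0 := by positivity
  have hQ₀' : (1 : ℝ) ≤ (Q₀ : ℝ) - 1 := by
    have : (2 : ℝ) ≤ Q₀ := by exact_mod_cast hQ₀
    linarith
  have hdiv : ∑ q ∈ 𝒬.filter (fun q => q ∣ m * n), Real.log q / (Q₀ - 1) ≤
      Real.log X / (Q₀ - 1) := by
    rw [← Finset.sum_div]
    gcongr
    refine (sum_log_le_of_prime_dvd hmn fun q hq => ?_).trans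
      (Real.log_le_log (by exact_mod_cast Nat.pos_of_ne_zero hmn) (by exact_mod_cast hX))
    exact ⟨(h𝒬 q (Finset.mem_filter.1 hq).1).1, (Finset.mem_filter.1 hq).2⟩
  have hterm : ∀ q ∈ 𝒬, Real.log q / q + Real.log q * congrKernel a q m n ≤
      (if q ∣ m * n - a then Real.log q else 0) +
        (if q ∣ m * n then Real.log q / (Q₀ - 1) else 0) := by
    intro q hq
    obtain ⟨hp, hge⟩ := h𝒬 q hq
    have hq1 : (1 : ℝ) ≤ (q : ℝ) - 1 := by
      have : (2 : ℝ) ≤ q := by exact_mod_cast hp.two_le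
      linarith
    have hlog : 0 ≤ Real.log q := Real.log_natCast_nonneg q
    have hcong : ((m : ZMod q) * (n : ZMod q) = (a : ZMod q)) ↔ q ∣ m * n - a := by
      rw [← Nat.cast_mul, eq_comm, ZMod.natCast_eq_natCast_iff, Nat.modEq_iff_dvd' ha.le]
    have hzero : ((m : ZMod q) * (n : ZMod q) = 0) ↔ q ∣ m * n := by
      rw [← Nat.cast_mul, ZMod.natCast_eq_zero_iff]
    have h1 : Real.log q / q ≤ Real.log q / (q - 1) := by gcongr; linarith
    have h2 : Real.log q / (q - 1) ≤ Real.log q / (Q₀ - 1) := by gcongr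
    have h3 : Real.log q * (1 / ((q : ℝ) - 1)) = Real.log q / (q - 1) := by ring
    rw [congrKernel]
    simp only [hcong, hzero]
    split_ifs <;> linarith
  have hsum := Finset.sum_le_sum hterm
  rw [Finset.sum_add_distrib, Finset.sum_add_distrib, ← Finset.sum_filter, ← Finset.sum_filter]
    at hsum
  linarith

theorem DyadicRange.card_headTailPairs_mul_le {X z B Q₀ Q₁ K : ℕ} {W : ℝ}
    (hR : DyadicRange X z B Q₀ Q₁ K W) {a : ℕ} (Y : ℕ) {𝒬 : Finset ℕ} (ha : 1 ≤ a) (haz : a < z)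
    (haQ : a < Q₀) (h𝒬 : ∀ q ∈ 𝒬, q.Prime ∧ Q₀ ≤ q ∧ q ≤ Q₁) {R : ℝ} (hQR : (Q₁ : ℝ) ≤ R)
    (hR1 : 1 ≤ R) :
    ((headTailPairs X z B Y).card : ℝ) *
        (∑ q ∈ 𝒬, Real.log q / q - Real.log X / (Q₀ - 1) - (Real.log X - Real.log R)) -
        24 * K ^ 6 * √(W * X) ≤
      (((Finset.Icc 1 X).filter
        (fun n : ℕ => (Pplus n : ℝ) ≤ R ∧ Pplus (n + a) ≤ Y)).card : ℝ) * Real.log R := by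
  set T := headTailPairs X z B Y with hT
  have hlt : ∀ p ∈ T, a < p.1 * p.2 := fun p hp => by
    have h := mem_headTailPairs.1 hp
    calc a < z := haz
      _ ≤ p.1 := h.2.1.le_head
      _ ≤ p.1 * p.2 := Nat.le_mul_of_pos_right _ h.1.2.1
  have herr := neg_le_of_abs_le (hR.abs_sum_headTailPairs_le (a := a) Y (𝒬 := 𝒬) fun q hq => by
    obtain ⟨h1, h2, h3⟩ := h𝒬 q hq
    refine ⟨h1, h2, h3, fun h => ?_⟩
    rw [ZMod.natCast_eq_zero_iff] at h
    exact absurd (Nat.le_of_dvd ha h) (by omega))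
  have hlower : ∀ p ∈ T, _ := fun p hp =>
    le_sum_log_of_congrKernel (Q₀ := Q₀) (a := a) (X := X) (𝒬 := 𝒬) (by omega)
      (fun q hq => ⟨(h𝒬 q hq).1, (h𝒬 q hq).2.1⟩) (mem_headTailPairs.1 hp).1.1.1
      (mem_headTailPairs.1 hp).1.2.1 (hlt p hp) (mem_headTailPairs.1 hp).2.2.2.1
  have hupper : ∀ p ∈ T, ∑ q ∈ 𝒬.filter (fun q => q ∣ p.1 * p.2 - a), Real.log q ≤
      (Real.log X - Real.log R) +
        (if (Pplus (p.1 * p.2 - a) : ℝ) ≤ R then Real.log R else 0) := by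
    intro p hp
    have h1 := hlt p hp
    have h2 := (mem_headTailPairs.1 hp).2.2.2.1
    split_ifs with h
    · have := sum_log_le_of_prime_dvd (s := 𝒬.filter (fun q => q ∣ p.1 * p.2 - a))
        (n := p.1 * p.2 - a) (by omega) fun q hq =>
          ⟨(h𝒬 q (Finset.mem_filter.1 hq).1).1, (Finset.mem_filter.1 hq).2⟩
      have h3 : Real.log (p.1 * p.2 - a : ℕ) ≤ Real.log X :=
        Real.log_le_log (by exact_mod_cast (by omega : 0 < p.1 * p.2 - a))
          (by exact_mod_cast (by omega : p.1 * p.2 - a ≤ X))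
      linarith
    · rw [add_zero]
      exact sum_log_le_of_prime_dvd_of_lt (by omega) (by omega) hR1
        (fun q hq => ⟨(h𝒬 q hq).1, le_trans (by exact_mod_cast (h𝒬 q hq).2.2) hQR⟩) (not_le.1 h)
  have hsum := (Finset.sum_le_sum hlower).trans (Finset.sum_le_sum hupper)
  rw [Finset.sum_add_distrib, Finset.sum_const, Finset.sum_add_distrib, Finset.sum_const,
    ← Finset.sum_filter, Finset.sum_const] at hsum
  simp only [nsmul_eq_mul] at hsum
  have hcard : (T.filter (fun p => (Pplus (p.1 * p.2 - a) : ℝ) ≤ R)).card ≤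
      ((Finset.Icc 1 X).filter
        (fun n : ℕ => (Pplus n : ℝ) ≤ R ∧ Pplus (n + a) ≤ Y)).card := by
    refine Finset.card_le_card_of_injOn (fun p => p.1 * p.2 - a) (fun p hp => ?_) ?_
    · obtain ⟨hp, hpR⟩ := Finset.mem_filter.1 (Finset.mem_coe.1 hp)
      have h1 := hlt p hp
      obtain ⟨⟨⟨h2, -⟩, h3, -⟩, -, -, h4, h5, h6⟩ := mem_headTailPairs.1 hp
      refine Finset.mem_coe.2 (Finset.mem_filter.2 ⟨Finset.mem_Icc.2 ⟨?_, ?_⟩, hpR, ?_⟩)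
      · exact (by omega : 1 ≤ p.1 * p.2 - a)
      · exact (by omega : p.1 * p.2 - a ≤ X)
      · rw [Nat.sub_add_cancel h1.le]
        exact Pplus_mul_le (by omega) (by omega) h5 h6
    · intro p hp p' hp' he
      have hp := (Finset.mem_filter.1 (Finset.mem_coe.1 hp)).1
      have hp' := (Finset.mem_filter.1 (Finset.mem_coe.1 hp')).1
      have h1 := hlt p hp
      have h2 := hlt p' hp'
      have he' : p.1 * p.2 = p'.1 * p'.2 := by simp only at he; omega
      have h3 := (mem_headTailPairs.1 hp).2.1.head_eq (by omega) (mem_headTailPairs.1 hp').2.1 he'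
      refine Prod.ext h3 ?_
      rw [← h3] at he'
      exact Nat.eq_of_mul_eq_mul_left (mem_headTailPairs.1 hp).1.1.1 he'
  have hlogR : 0 ≤ Real.log R := Real.log_nonneg hR1
  have hcard' := mul_le_mul_of_nonneg_right (Nat.cast_le (α := ℝ).2 hcard) hlogR
  linarith

theorem card_le_card_headTailPairs {X z B Y : ℕ} (hz : 2 ≤ z) :
    ((Finset.Icc z X).filter (fun m => Pplus m ≤ Y ∧ z * Pplus m ≤ B)).card ≤
      (headTailPairs X z B Y).card := by
  refine le_trans (Finset.card_le_card fun m hm => ?_)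
    (Finset.card_image_le (s := headTailPairs X z B Y) (f := fun p => p.1 * p.2))
  simp only [Finset.mem_filter, Finset.mem_Icc] at hm
  obtain ⟨⟨hzm, hmX⟩, hmY, hmB⟩ := hm
  obtain ⟨m₁, m₂, rfl, h⟩ := exists_isHeadTail hz m hzm
  have h0 : m₁ * m₂ ≠ 0 := by omega
  have h1 : 0 < m₁ := Nat.pos_of_ne_zero (left_ne_zero_of_mul h0)
  have h2 : 0 < m₂ := Nat.pos_of_ne_zero (right_ne_zero_of_mul h0)
  have hP1 : Pplus m₁ ≤ Pplus (m₁ * m₂) := Pplus_le_of_dvd h0 (Dvd.intro _ rfl)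
  have hP2 : Pplus m₂ ≤ Pplus (m₁ * m₂) := Pplus_le_of_dvd h0 (Dvd.intro_left _ rfl)
  refine Finset.mem_image.2 ⟨(m₁, m₂), mem_headTailPairs.2 ⟨⟨⟨h1, ?_⟩, h2, ?_⟩, h, ?_, hmX,
    hP1.trans hmY, hP2.trans hmY⟩, rfl⟩
  · exact (Nat.le_mul_of_pos_right _ h2).trans hmX
  · exact (Nat.le_mul_of_pos_left _ h1).trans hmX
  · exact h.head_lt.le.trans ((Nat.mul_le_mul_left z hP1).trans hmB)

theorem one_sub_mul_Psi_le_card_headTailPairs {x y τ : ℝ} (hx : 1 ≤ x) (hxτ : 2 ≤ x ^ τ)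
    (hcard : (1 - 8 * τ) * Psi x y ≤ (((Finset.Icc 1 ⌊x⌋₊).filter
      (fun m : ℕ => (Pplus m : ℝ) ≤ y ∧ (Pplus m : ℝ) ≤ x ^ (1 - 2 * τ))).card : ℝ))
    (hsmall : 2 * x ^ τ ≤ τ * Psi x y) :
    (1 - 9 * τ) * Psi x y ≤
      ((headTailPairs ⌊x⌋₊ (⌊x ^ τ⌋₊ + 1) ⌊2 * x ^ (1 - τ)⌋₊ ⌊y⌋₊).card : ℝ) := by
  have hx0 : 0 < x := by linarith
  set z := ⌊x ^ τ⌋₊ + 1 with hz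
  have hz2 : 2 ≤ z := by
    have : 2 ≤ ⌊x ^ τ⌋₊ := Nat.le_floor (by exact_mod_cast hxτ)
    omega
  have hzx : (z : ℝ) ≤ 2 * x ^ τ := by
    have := Nat.floor_le (a := x ^ τ) (by linarith)
    rw [hz]; push_cast; linarith
  have hsub : (Finset.Icc 1 ⌊x⌋₊).filter
      (fun m : ℕ => (Pplus m : ℝ) ≤ y ∧ (Pplus m : ℝ) ≤ x ^ (1 - 2 * τ)) ⊆
      (Finset.Icc z ⌊x⌋₊).filter
        (fun m => Pplus m ≤ ⌊y⌋₊ ∧ z * Pplus m ≤ ⌊2 * x ^ (1 - τ)⌋₊) ∪ Finset.Ico 1 z := by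
    intro m hm
    simp only [Finset.mem_filter, Finset.mem_Icc, Finset.mem_union, Finset.mem_Ico] at hm ⊢
    obtain ⟨⟨h1, h2⟩, h3, h4⟩ := hm
    rcases le_or_gt z m with h | h
    · refine Or.inl ⟨⟨h, h2⟩, Nat.le_floor h3, Nat.le_floor ?_⟩
      push_cast
      calc (z : ℝ) * Pplus m ≤ 2 * x ^ τ * x ^ (1 - 2 * τ) := by gcongr
        _ = 2 * x ^ (1 - τ) := by
            rw [mul_assoc, ← Real.rpow_add hx0]; congr 2; ring
    · exact Or.inr ⟨h1, h⟩
  have h := (Finset.card_le_card hsub).trans (Finset.card_union_le _ _)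
  rw [Nat.card_Ico] at h
  have h' : (((Finset.Icc 1 ⌊x⌋₊).filter
      (fun m : ℕ => (Pplus m : ℝ) ≤ y ∧ (Pplus m : ℝ) ≤ x ^ (1 - 2 * τ))).card : ℝ) ≤
      ((headTailPairs ⌊x⌋₊ z ⌊2 * x ^ (1 - τ)⌋₊ ⌊y⌋₊).card : ℝ) + z := by
    have := card_le_card_headTailPairs (X := ⌊x⌋₊) (B := ⌊2 * x ^ (1 - τ)⌋₊) (Y := ⌊y⌋₊) hz2
    exact_mod_cast (by omega)
  linarith

theorem dyadicRange_of_rpow {x τ : ℝ} (hx : 1 ≤ x) (hτ : 0 < τ) (hτ1 : τ ≤ 1 / 4)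
    (hxτ : 2 ≤ x ^ τ) :
    DyadicRange ⌊x⌋₊ (⌊x ^ τ⌋₊ + 1) ⌊2 * x ^ (1 - τ)⌋₊ (⌊x ^ τ⌋₊ + 1) ⌊x ^ (1 / 2 - τ)⌋₊
      (Nat.log 2 (2 * ⌊x⌋₊ + 2) + 1) (4 * x ^ (1 - τ)) := by
  have hx0 : 0 < x := by linarith
  have hfloor : (⌊x⌋₊ : ℝ) ≤ x := Nat.floor_le hx0.le
  have hz : x ^ τ ≤ ((⌊x ^ τ⌋₊ + 1 : ℕ) : ℝ) := by
    push_cast; exact (Nat.lt_floor_add_one _).le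
  have h1 : 1 ≤ x ^ (1 - τ) := Real.one_le_rpow hx (by linarith)
  have hmul : x ^ (1 - τ) * x ^ τ = x := by rw [← Real.rpow_add hx0]; simp
  refine ⟨by linarith, Nat.floor_mono ?_, by omega, Nat.floor_mono ?_,
    (Nat.lt_pow_succ_log_self (by norm_num) _).le, ?_, ?_, ?_, ?_⟩
  · nlinarith
  · calc x ^ (1 / 2 - τ) ≤ x ^ (1 : ℝ) := Real.rpow_le_rpow_of_exponent_le hx (by linarith)
      _ = x := Real.rpow_one x
  · calc (⌊x⌋₊ : ℝ) ≤ x := hfloor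
      _ = x ^ (1 - τ) * x ^ τ := hmul.symm
      _ ≤ 4 * x ^ (1 - τ) * (x ^ τ) ^ 2 := by
          have : 0 ≤ x ^ (1 - τ) * x ^ τ := by rw [hmul]; exact hx0.le
          nlinarith
      _ ≤ _ := by gcongr
  · exact (Nat.floor_le (by linarith)).trans (by linarith)
  · calc (⌊x⌋₊ : ℝ) ≤ x := hfloor
      _ = x ^ (1 - τ) * x ^ τ := hmul.symm
      _ ≤ 4 * x ^ (1 - τ) * ((⌊x ^ τ⌋₊ + 1 : ℕ) : ℝ) := by gcongr; linarith
  · calc ((⌊x ^ (1 / 2 - τ)⌋₊ : ℕ) : ℝ) ^ 2 ≤ (x ^ (1 / 2 - τ)) ^ 2 := by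
          gcongr; exact Nat.floor_le (by positivity)
      _ = x ^ (1 - 2 * τ) := by
          rw [← Real.rpow_natCast, ← Real.rpow_mul hx0.le]; congr 1; push_cast; ring
      _ ≤ x ^ (1 - τ) := Real.rpow_le_rpow_of_exponent_le hx (by linarith)
      _ ≤ _ := by linarith

theorem natLog_le_two_mul_log {x : ℝ} (hx : 1 ≤ x) (hlog : 6 ≤ Real.log x) :
    ((Nat.log 2 (2 * ⌊x⌋₊ + 2) + 1 : ℕ) : ℝ) ≤ 2 * Real.log x := by
  have hx0 : 0 < x := by linarith
  set k := Nat.log 2 (2 * ⌊x⌋₊ + 2)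
  have h1 : ((2 ^ k : ℕ) : ℝ) ≤ 2 ^ 2 * x := by
    have h2 : 2 ^ k ≤ 2 * ⌊x⌋₊ + 2 := Nat.pow_log_le_self 2 (by omega)
    calc ((2 ^ k : ℕ) : ℝ) ≤ ((2 * ⌊x⌋₊ + 2 : ℕ) : ℝ) := by exact_mod_cast h2
      _ ≤ 2 ^ 2 * x := by push_cast; linarith [Nat.floor_le hx0.le]
  have h2 := Real.log_le_log (by positivity) h1
  rw [Real.log_mul (by norm_num) hx0.ne', Real.log_pow] at h2
  push_cast at h2
  rw [Real.log_pow] at h2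
  have h3 := Real.log_two_gt_d9
  have h4 := Real.log_two_lt_d9
  push_cast
  nlinarith

/-- The bilinear error term is negligible. -/
theorem error_le_of_log_pow_le {x τ Ψ : ℝ} (hx : 1 ≤ x) (hlog : 6 ≤ Real.log x)
    (hpow : 3072 * Real.log x ^ 5 ≤ τ * x ^ (τ / 4)) (hΨ : x ^ (1 - τ / 4) ≤ Ψ) (hτ : 0 < τ) :
    24 * ((Nat.log 2 (2 * ⌊x⌋₊ + 2) + 1 : ℕ) : ℝ) ^ 6 * √(4 * x ^ (1 - τ) * ⌊x⌋₊) ≤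
      τ * Ψ * Real.log x := by
  have hx0 : 0 < x := by linarith
  have hsqrt : √(4 * x ^ (1 - τ) * ⌊x⌋₊) ≤ 2 * x ^ (1 - τ / 2) := by
    refine Real.sqrt_le_iff.2 ⟨by positivity, ?_⟩
    calc 4 * x ^ (1 - τ) * ⌊x⌋₊ ≤ 4 * x ^ (1 - τ) * x ^ (1 : ℝ) := by
          rw [Real.rpow_one]; gcongr; exact Nat.floor_le hx0.le
      _ = (2 * x ^ (1 - τ / 2)) ^ 2 := by
          rw [mul_pow, ← Real.rpow_natCast (x ^ (1 - τ / 2)), ← Real.rpow_mul hx0.le, mul_assoc,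
            ← Real.rpow_add hx0]
          norm_num
          ring_nf
  calc _ ≤ 24 * (2 * Real.log x) ^ 6 * (2 * x ^ (1 - τ / 2)) := by
        gcongr; exact natLog_le_two_mul_log hx hlog
    _ = 3072 * Real.log x ^ 5 * x ^ (1 - τ / 2) * Real.log x := by ring
    _ ≤ τ * x ^ (τ / 4) * x ^ (1 - τ / 2) * Real.log x := by gcongr
    _ = τ * x ^ (1 - τ / 4) * Real.log x := by
        rw [mul_assoc τ, ← Real.rpow_add hx0]; congr 3; ring
    _ ≤ _ := by gcongr

theorem eventually_parameters {a : ℕ} {τ : ℝ} (C : ℝ) (hτ : 0 < τ) (hτ1 : τ ≤ 1 / 4) :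
    ∀ᶠ x : ℝ in Filter.atTop, 6 ≤ Real.log x ∧ C ≤ τ * Real.log x ∧ 2 ≤ x ^ τ ∧
      (a : ℝ) + 1 ≤ x ^ τ ∧ 1 / τ + 1 ≤ x ^ τ ∧ 2 * x ^ τ ≤ τ * x ^ (1 - τ / 4) ∧
      3072 * Real.log x ^ 5 ≤ τ * x ^ (τ / 4) := by
  have h1 := tendsto_rpow_atTop hτ
  have h2 := tendsto_rpow_atTop (y := 1 - τ / 4 - τ) (by linarith)
  have h3 := (isLittleO_log_rpow_rpow_atTop (5 : ℕ) (by positivity : 0 < τ / 4)).def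
    (c := τ / 3072) (by positivity)
  filter_upwards [Filter.eventually_gt_atTop 1, Real.tendsto_log_atTop.eventually_ge_atTop 6,
    Real.tendsto_log_atTop.eventually_ge_atTop (C / τ), h1.eventually_ge_atTop 2,
    h1.eventually_ge_atTop (a + 1), h1.eventually_ge_atTop (1 / τ + 1),
    h2.eventually_ge_atTop (2 / τ), h3] with x hx1 hlog hC hx2 ha hxτ hsmall hpow
  have hx0 : 0 < x := by linarith
  refine ⟨hlog, ?_, hx2, ha, hxτ, ?_, ?_⟩
  · rw [div_le_iff₀ hτ] at hC; linarith
  · rw [div_le_iff₀ hτ] at hsmall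
    have : x ^ (1 - τ / 4) = x ^ (1 - τ / 4 - τ) * x ^ τ := by
      rw [← Real.rpow_add hx0]; congr 1; ring
    rw [this]
    nlinarith [Real.rpow_pos_of_pos hx0 τ]
  · rw [Real.rpow_natCast, Real.norm_of_nonneg (by positivity),
      Real.norm_of_nonneg (by positivity)] at hpow
    linarith

theorem mul_le_of_mul_inv_le {T G P u τ : ℝ} (hu1 : 1 < u) (hu2 : u ≤ 2) (hτ : 0 ≤ τ)
    (hu : 0 ≤ 1 - u / 2 - 8 * τ) (hT0 : 0 ≤ T) (hP : 0 ≤ P) (hT : (1 - 9 * τ) * P ≤ T)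
    (h : T * (1 / 2 - 4 * τ - 1 + 1 / u) - τ * P ≤ G * (1 / u)) :
    (1 - u / 2 - 19 * τ) * P ≤ G := by
  have hu0 : 0 < u := by linarith
  have h1 : T * (1 - u / 2 - 4 * (τ * u)) - τ * u * P ≤ G := by
    have h2 := mul_le_mul_of_nonneg_right h hu0.le
    have h3 : G * (1 / u) * u = G := by field_simp
    have h4 : (T * (1 / 2 - 4 * τ - 1 + 1 / u) - τ * P) * u =
        T * (1 - u / 2 - 4 * (τ * u)) - τ * u * P := by
      have : 1 / u * u = 1 := by field_simp
      linear_combination T * this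
    linarith
  have hτu : τ * u ≤ 2 * τ := by nlinarith
  have h2 : T * (1 - u / 2 - 8 * τ) ≤ T * (1 - u / 2 - 4 * (τ * u)) :=
    mul_le_mul_of_nonneg_left (by linarith) hT0
  have h3 : τ * u * P ≤ 2 * τ * P := mul_le_mul_of_nonneg_right hτu hP
  have h4 : (1 - 9 * τ) * P * (1 - u / 2 - 8 * τ) ≤ T * (1 - u / 2 - 8 * τ) :=
    mul_le_mul_of_nonneg_right hT hu
  have h5 : P * τ * (1 - u / 2 - 8 * τ) ≤ P * τ * 1 :=
    mul_le_mul_of_nonneg_left (by linarith) (mul_nonneg hP hτ)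
  linarith

theorem mul_Psi_le_card_of_parameters {a : ℕ} (ha : 1 ≤ a) {u τ x y C : ℝ} (hu1 : 1 < u)
    (hu2 : u ≤ 2) (hτ : 0 < τ) (hτ1 : τ ≤ 1 / 100) (hx : 1 ≤ x) (hy : 1 ≤ y)
    (hu : 0 ≤ 1 - u / 2 - 8 * τ)
    (hC : ∀ y x : ℝ, 1 ≤ y → y ≤ x →
      |∑ p ∈ (Finset.Ioc ⌊y⌋₊ ⌊x⌋₊).filter Nat.Prime, Real.log p / p -
        (Real.log x - Real.log y)| ≤ C)
    (hlog : 6 ≤ Real.log x) (hCx : C ≤ τ * Real.log x) (hx2 : 2 ≤ x ^ τ)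
    (hax : (a : ℝ) + 1 ≤ x ^ τ) (hxτ : 1 / τ + 1 ≤ x ^ τ)
    (hsmall : 2 * x ^ τ ≤ τ * x ^ (1 - τ / 4))
    (hpow : 3072 * Real.log x ^ 5 ≤ τ * x ^ (τ / 4)) (hΨ : x ^ (1 - τ / 4) ≤ Psi x y)
    (hcard : (1 - 8 * τ) * Psi x y ≤ (((Finset.Icc 1 ⌊x⌋₊).filter
      (fun m : ℕ => (Pplus m : ℝ) ≤ y ∧ (Pplus m : ℝ) ≤ x ^ (1 - 2 * τ))).card : ℝ)) :
    (1 - u / 2 - 19 * τ) * Psi x y ≤ (((Finset.Icc 1 ⌊x⌋₊).filter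
      (fun n : ℕ => (Pplus n : ℝ) ≤ x ^ (1 / u) ∧ (Pplus (n + a) : ℝ) ≤ y)).card : ℝ) := by
  have hx0 : 0 < x := by linarith
  have hR := dyadicRange_of_rpow hx hτ (by linarith) hx2
  have hT := one_sub_mul_Psi_le_card_headTailPairs hx hx2 hcard
    (hsmall.trans (by gcongr))
  have herr := error_le_of_log_pow_le hx hlog hpow hΨ hτ
  have haz : a < ⌊x ^ τ⌋₊ + 1 := by
    have : a + 1 ≤ ⌊x ^ τ⌋₊ := Nat.le_floor (by exact_mod_cast hax)
    omega
  have huhalf : 1 / 2 ≤ 1 / u := one_div_le_one_div_of_le (by linarith) hu2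
  have hmain := hR.card_headTailPairs_mul_le (a := a) ⌊y⌋₊
    (𝒬 := (Finset.Ioc ⌊x ^ τ⌋₊ ⌊x ^ (1 / 2 - τ)⌋₊).filter Nat.Prime) ha haz haz
    (fun q hq => by
      simp only [Finset.mem_filter, Finset.mem_Ioc] at hq
      exact ⟨hq.2, hq.1.1, hq.1.2⟩)
    (R := x ^ (1 / u))
    ((Nat.floor_le (by positivity)).trans
      (Real.rpow_le_rpow_of_exponent_le hx (by linarith)))
    (Real.one_le_rpow hx (by positivity))
  have hfilter : (Finset.Icc 1 ⌊x⌋₊).filter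
      (fun n : ℕ => (Pplus n : ℝ) ≤ x ^ (1 / u) ∧ Pplus (n + a) ≤ ⌊y⌋₊) =
      (Finset.Icc 1 ⌊x⌋₊).filter
        (fun n : ℕ => (Pplus n : ℝ) ≤ x ^ (1 / u) ∧ (Pplus (n + a) : ℝ) ≤ y) :=
    Finset.filter_congr fun n _ => by rw [Nat.le_floor_iff (by linarith)]
  rw [hfilter, Real.log_rpow hx0] at hmain
  set G := (((Finset.Icc 1 ⌊x⌋₊).filter
    (fun n : ℕ => (Pplus n : ℝ) ≤ x ^ (1 / u) ∧ (Pplus (n + a) : ℝ) ≤ y)).card : ℝ)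
  set T := ((headTailPairs ⌊x⌋₊ (⌊x ^ τ⌋₊ + 1) ⌊2 * x ^ (1 - τ)⌋₊ ⌊y⌋₊).card : ℝ)
  have hT0 : 0 ≤ T := Nat.cast_nonneg _
  have hΨ0 : (0 : ℝ) ≤ Psi x y := Nat.cast_nonneg _
  obtain ⟨L, hL⟩ : ∃ L, L = Real.log x := ⟨_, rfl⟩
  have hlogX : Real.log ⌊x⌋₊ ≤ L := by
    rw [hL]
    exact Real.log_le_log (by exact_mod_cast Nat.floor_pos.2 hx) (Nat.floor_le hx0.le)
  have hmertens := (abs_le.1 (hC (x ^ τ) (x ^ (1 / 2 - τ)) (by linarith)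
    (Real.rpow_le_rpow_of_exponent_le hx (by linarith)))).1
  rw [Real.log_rpow hx0, Real.log_rpow hx0] at hmertens
  have hdiv : Real.log ⌊x⌋₊ / (((⌊x ^ τ⌋₊ + 1 : ℕ) : ℝ) - 1) ≤ τ * L := by
    have h1 : 1 / τ ≤ ⌊x ^ τ⌋₊ := by linarith [Nat.lt_floor_add_one (x ^ τ)]
    have h2 : (0 : ℝ) < ⌊x ^ τ⌋₊ := lt_of_lt_of_le (by positivity) h1
    push_cast
    rw [add_sub_cancel_right, div_le_iff₀ h2]
    rw [div_le_iff₀ hτ] at h1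
    nlinarith
  rw [← hL] at hmain herr hmertens hCx hlog
  have hcoef : (1 / 2 - 4 * τ - 1 + 1 / u) * L ≤
      ∑ q ∈ (Finset.Ioc ⌊x ^ τ⌋₊ ⌊x ^ (1 / 2 - τ)⌋₊).filter Nat.Prime, Real.log q / q -
        Real.log ⌊x⌋₊ / (((⌊x ^ τ⌋₊ + 1 : ℕ) : ℝ) - 1) - (Real.log ⌊x⌋₊ - 1 / u * L) := by
    linarith
  have h1 : T * ((1 / 2 - 4 * τ - 1 + 1 / u) * L) - τ * Psi x y * L ≤ G * (1 / u * L) :=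
    le_trans (sub_le_sub (mul_le_mul_of_nonneg_left hcoef hT0) herr) hmain
  have h2 : T * (1 / 2 - 4 * τ - 1 + 1 / u) - τ * Psi x y ≤ G * (1 / u) := by
    have hL0 : 0 < L := by linarith
    refine le_of_mul_le_mul_right ?_ hL0
    linarith
  exact mul_le_of_mul_inv_le hu1 hu2 hτ.le hu hT0 hΨ0 hT h2

/-- Shifted friable numbers, unconditional case via Harper's theorem (Théorème 1.8, (1.12)). -/
theorem shifted_friable_harper
    (a : ℕ) (ha : 1 ≤ a) (u : ℝ) (hu1 : 1 < u) (hu2 : u ≤ 2)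
    (ε : ℝ) (hε : 0 < ε) :
    ∃ δ : ℝ, 0 < δ ∧ ∃ x₀ : ℝ, ∀ x : ℝ, x₀ ≤ x →
      ∀ v : ℝ, 1 ≤ v → v ≤ δ * Real.log x / Real.log (Real.log x) →
      (1 - u / 2 - ε) * (Psi x (x ^ (1 / v : ℝ)) : ℝ) ≤
        (((Finset.Icc 1 ⌊x⌋₊).filter
            (fun n => (Pplus n : ℝ) ≤ x ^ (1 / u : ℝ) ∧
              (Pplus (n + a) : ℝ) ≤ x ^ (1 / v : ℝ))).card : ℝ) := by
  obtain ⟨τ, hτ, hτ1, hτε⟩ : ∃ τ : ℝ, 0 < τ ∧ τ ≤ 1 / 100 ∧ 19 * τ ≤ ε :=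
    ⟨min ε 1 / 100, by positivity, by linarith [min_le_right ε 1], by
      linarith [min_le_left ε 1, lt_min hε one_pos]⟩
  obtain ⟨C, -, hC⟩ := exists_abs_sum_log_div_sub_le
  refine ⟨τ / 4 / 8, by positivity, Filter.eventually_atTop.1 ?_⟩
  filter_upwards [Filter.eventually_ge_atTop 1,
    eventually_rpow_le_Psi (τ := τ / 4) (by positivity) (by linarith),
    eventually_mul_Psi_le_card hτ hτ1,
    eventually_parameters (a := a) C hτ (by linarith)] with x hx hΨ hcard hpar v hv hv'
  obtain ⟨h1, h2, h3, h4, h5, h6, h7⟩ := hpar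
  have hΨ0 : (0 : ℝ) ≤ Psi x (x ^ (1 / v)) := Nat.cast_nonneg _
  rcases le_or_gt 0 (1 - u / 2 - 8 * τ) with hu | hu
  · refine le_trans ?_ (mul_Psi_le_card_of_parameters ha hu1 hu2 hτ hτ1 hx
      (Real.one_le_rpow hx (by positivity)) hu hC h1 h2 h3 h4 h5 h6 h7 (hΨ v hv hv')
      (hcard (x ^ (1 / v))))
    gcongr
  · exact (mul_nonpos_of_nonpos_of_nonneg (by linarith) hΨ0).trans (Nat.cast_nonneg _)
end

section
/- Let 0 ≤ v < 1 and 1 + v < u ≤ 2. Then μ^{(1)}(u,v) = 1 − v + log((1+v)/u). -/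
open MeasureTheory

/-- The region `V_k(u,v)`. -/
def Vk (k : ℕ) (u v : ℝ) : Set (Fin k → ℝ) :=
  {t | (∀ i, t i ∈ Set.Ioo (0:ℝ) 1) ∧
    (∑ i ∈ Finset.univ.filter (fun i : Fin k => (i : ℕ) < k - 1), t i) < u - 1 ∧
    u - 1 < ∑ i, t i ∧ ∑ i, t i < u - v}

/-- The function `μ_k(u,v)`. -/
noncomputable def muk (k : ℕ) (u v : ℝ) : ℝ :=
  if k = 1 then
    u⁻¹ * (volume (Set.Ioo (0:ℝ) 1 ∩ Set.Ioo (u-1) (u-v))).toReal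
  else
    u⁻¹ * ∫ t in Vk k u v,
      ∏ j ∈ Finset.univ.filter (fun j : Fin k => (j : ℕ) < k - 1),
        (u - ∑ i ∈ Finset.univ.filter (fun i : Fin k => i ≤ j), t i)⁻¹

/-- `μ^{(κ)}(u,v) = ∑_{k ≥ 1} κ^k μ_k(u,v)`. -/
noncomputable def mukappa (κ u v : ℝ) : ℝ := ∑' k : ℕ, κ ^ (k+1) * muk (k+1) u v

/-- The integral defining `μ_k(u,v)`, without the factor `u⁻¹`. -/
noncomputable def mukIntegral (k : ℕ) (u v : ℝ) : ℝ :=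
  ∫ t in Vk k u v,
    ∏ j ∈ Finset.univ.filter (fun j : Fin k => (j : ℕ) < k - 1),
      (u - ∑ i ∈ Finset.univ.filter (fun i : Fin k => i ≤ j), t i)⁻¹

theorem measurableSet_Vk (k : ℕ) (u v : ℝ) : MeasurableSet (Vk k u v) := by
  have h : ∀ s : Finset (Fin k), Measurable fun t : Fin k → ℝ => ∑ i ∈ s, t i :=
    fun s => by fun_prop
  refine MeasurableSet.inter ?_ (MeasurableSet.inter ?_ (MeasurableSet.inter ?_ ?_))
  · exact MeasurableSet.univ_pi' fun _ => measurableSet_Ioo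
  · exact measurableSet_lt (h _) measurable_const
  · exact measurableSet_lt measurable_const (h _)
  · exact measurableSet_lt (h _) measurable_const

theorem integrableOn_Vk (k : ℕ) (u v : ℝ) :
    IntegrableOn (fun t : Fin k → ℝ =>
      ∏ j ∈ Finset.univ.filter (fun j : Fin k => (j : ℕ) < k - 1),
        (u - ∑ i ∈ Finset.univ.filter (fun i : Fin k => i ≤ j), t i)⁻¹) (Vk k u v) := by
  have hfin : volume (Vk k u v) < ⊤ := by
    refine (measure_mono (t := Set.univ.pi fun _ => Set.Ioo (0 : ℝ) 1)
      fun t ht i _ => ht.1 i).trans_lt ?_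
    simp [Real.volume_pi_Ioo]
  refine Measure.integrableOn_of_bounded (M := 1) hfin.ne ?_ ?_
  · exact Measurable.aestronglyMeasurable (by fun_prop)
  · refine (ae_restrict_iff' (measurableSet_Vk k u v)).2 (Filter.Eventually.of_forall ?_)
    intro t ht
    rw [norm_prod]
    refine Finset.prod_le_one (fun _ _ => norm_nonneg _) fun j hj => ?_
    have hle : ∑ i ∈ Finset.univ.filter (fun i : Fin k => i ≤ j), t i ≤
        ∑ i ∈ Finset.univ.filter (fun i : Fin k => (i : ℕ) < k - 1), t i := by
      refine Finset.sum_le_sum_of_subset_of_nonneg ?_ fun i _ _ => (ht.1 i).1.le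
      intro i hi
      simp only [Finset.mem_filter, Finset.mem_univ, true_and] at hi hj ⊢
      exact lt_of_le_of_lt hi hj
    have hlt := ht.2.1
    have h1 : 1 ≤ u - ∑ i ∈ Finset.univ.filter (fun i : Fin k => i ≤ j), t i := by linarith
    rw [norm_inv, Real.norm_of_nonneg (by linarith)]
    exact inv_le_one_of_one_le₀ h1

theorem Vk_eq_empty {k : ℕ} {u v : ℝ} (hu : u ≤ 1) : Vk k u v = ∅ := by
  refine Set.eq_empty_of_forall_notMem fun t ht => ?_
  have h0 : 0 ≤ ∑ i ∈ Finset.univ.filter (fun i : Fin k => (i : ℕ) < k - 1), t i :=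
    Finset.sum_nonneg fun i _ => (ht.1 i).1.le
  linarith [ht.2.1]

theorem cons_mem_Vk {k : ℕ} {u v x : ℝ} {t : Fin (k + 1) → ℝ} :
    (Fin.cons x t : Fin (k + 2) → ℝ) ∈ Vk (k + 2) u v ↔
      x ∈ Set.Ioo (0 : ℝ) 1 ∧ t ∈ Vk (k + 1) (u - x) v := by
  simp only [Vk, Set.mem_ofPred_eq, Fin.forall_fin_succ (n := k + 1), Finset.sum_filter,
    Fin.sum_univ_succ (n := k + 1), Fin.cons_zero, Fin.cons_succ, Fin.val_zero, Fin.val_succ,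
    and_assoc]
  simp only [Nat.add_sub_cancel, show k + 2 - 1 = k + 1 from rfl, Nat.succ_pos, if_true,
    add_lt_add_iff_right]
  refine and_congr_right fun _ => and_congr_right fun _ => ?_
  constructor <;> rintro ⟨h1, h2, h3⟩ <;> refine ⟨by linarith, by linarith, by linarith⟩

theorem prod_inv_sub_sum_cons {k : ℕ} {u x : ℝ} {t : Fin (k + 1) → ℝ} :
    (∏ j ∈ Finset.univ.filter (fun j : Fin (k + 2) => (j : ℕ) < k + 2 - 1),
      (u - ∑ i ∈ Finset.univ.filter (fun i : Fin (k + 2) => i ≤ j),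
        (Fin.cons x t : Fin (k + 2) → ℝ) i)⁻¹) =
    (u - x)⁻¹ * ∏ j ∈ Finset.univ.filter (fun j : Fin (k + 1) => (j : ℕ) < k + 1 - 1),
      (u - x - ∑ i ∈ Finset.univ.filter (fun i : Fin (k + 1) => i ≤ j), t i)⁻¹ := by
  simp only [Finset.sum_filter, Finset.prod_filter, Fin.prod_univ_succ (n := k + 1),
    Fin.sum_univ_succ (n := k + 1), Fin.cons_zero, Fin.cons_succ, Fin.val_zero, Fin.val_succ]
  simp [sub_sub]

theorem mukIntegral_add_two (k : ℕ) (u v : ℝ) :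
    mukIntegral (k + 2) u v =
      ∫ x in Set.Ioo (0 : ℝ) 1, (u - x)⁻¹ * mukIntegral (k + 1) (u - x) v := by
  have hG := (integrable_indicator_iff (measurableSet_Vk (k + 2) u v)).2
    (integrableOn_Vk (k + 2) u v)
  have hmp := (volume_preserving_piFinSuccAbove (fun _ : Fin (k + 2) => ℝ) 0).symm
  rw [mukIntegral, ← integral_indicator (measurableSet_Vk _ u v),
    ← hmp.integral_comp (MeasurableEquiv.measurableEmbedding _), Measure.volume_eq_prod,
    integral_prod (fun z => Set.indicator _ _ _) (hmp.integrable_comp_of_integrable hG),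
    ← integral_indicator measurableSet_Ioo]
  refine integral_congr_ae (Filter.Eventually.of_forall fun x => ?_)
  have hcons : ∀ t : Fin (k + 1) → ℝ,
      (MeasurableEquiv.piFinSuccAbove (fun _ : Fin (k + 2) => ℝ) 0).symm (x, t) =
        (Fin.cons x t : Fin (k + 2) → ℝ) := fun t => by
    simp [MeasurableEquiv.piFinSuccAbove, Fin.consEquiv]
  simp only [hcons]
  by_cases hx : x ∈ Set.Ioo (0 : ℝ) 1
  · rw [Set.indicator_of_mem hx, mukIntegral, ← integral_indicator (measurableSet_Vk _ _ v),
      ← integral_const_mul]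
    refine integral_congr_ae (Filter.Eventually.of_forall fun t => ?_)
    by_cases ht : t ∈ Vk (k + 1) (u - x) v
    · simp only [Set.indicator_of_mem ht, Set.indicator_of_mem (cons_mem_Vk.2 ⟨hx, ht⟩)]
      exact prod_inv_sub_sum_cons
    · simp only [Set.indicator_of_notMem ht, mul_zero]
      exact Set.indicator_of_notMem (fun h => ht (cons_mem_Vk.1 h).2) _
  · rw [Set.indicator_of_notMem hx]
    refine integral_eq_zero_of_ae (Filter.Eventually.of_forall fun t => ?_)
    exact Set.indicator_of_notMem (fun h => hx (cons_mem_Vk.1 h).1) _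

theorem mukIntegral_one {u v : ℝ} (hu : 1 < u) :
    mukIntegral 1 u v = (volume (Set.Ioo (0 : ℝ) 1 ∩ Set.Ioo (u - 1) (u - v))).toReal := by
  have hV : Vk 1 u v = MeasurableEquiv.funUnique (Fin 1) ℝ ⁻¹'
      (Set.Ioo (0 : ℝ) 1 ∩ Set.Ioo (u - 1) (u - v)) := by
    ext t
    simp [Vk, hu]
  have hmeas := (volume_preserving_funUnique (Fin 1) ℝ).measure_preimage_equiv
    (Set.Ioo (0 : ℝ) 1 ∩ Set.Ioo (u - 1) (u - v))
  rw [← hmeas, ← hV]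
  simp [mukIntegral, Measure.real]
  congr!

theorem muk_eq_inv_mul_mukIntegral {u : ℝ} (k : ℕ) (v : ℝ) (hu : 1 < u) :
    muk k u v = u⁻¹ * mukIntegral k u v := by
  by_cases hk : k = 1
  · subst hk
    simp [muk, mukIntegral_one hu]
  · simp [muk, mukIntegral, hk]

/-- The values `μ_{k+1}(u,v)` for `1 < u ≤ 2`, by recursion on `k`. -/
noncomputable def mukRec (v : ℝ) : ℕ → ℝ → ℝ
  | 0, u => u⁻¹ * (min 1 (u - v) - (u - 1))
  | k + 1, u => u⁻¹ * ∫ w in (1 : ℝ)..u, mukRec v k w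

theorem muk_eq_mukRec {v : ℝ} (hv : v < 1) (k : ℕ) {u : ℝ} (hu : 1 < u)
    (hu2 : u ≤ 2) : muk (k + 1) u v = mukRec v k u := by
  induction k generalizing u with
  | zero =>
    have hle : u - 1 ≤ min 1 (u - v) := le_min (by linarith) (by linarith)
    simp only [muk, mukRec, zero_add, if_true, Set.Ioo_inter_Ioo, Real.volume_Ioo]
    rw [sup_eq_right.2 (by linarith : (0 : ℝ) ≤ u - 1),
      ENNReal.toReal_ofReal (sub_nonneg.2 hle)]
  | succ k ih =>
    rw [muk_eq_inv_mul_mukIntegral _ v hu, mukIntegral_add_two, mukRec]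
    congr 1
    have hsub : Set.Ioo (0 : ℝ) (u - 1) ⊆ Set.Ioo 0 1 :=
      Set.Ioo_subset_Ioo_right (by linarith)
    rw [setIntegral_eq_of_subset_of_forall_sdiff_eq_zero measurableSet_Ioo hsub,
      setIntegral_congr_fun (g := fun x => mukRec v k (u - x)) measurableSet_Ioo,
      ← integral_Ioc_eq_integral_Ioo, ← intervalIntegral.integral_of_le (by linarith),
      intervalIntegral.integral_comp_sub_left (fun w => mukRec v k w)]
    · simp
    · intro x hx
      have h1 : 1 < u - x := by linarith [hx.2]
      simp only
      rw [← ih h1 (by linarith [hx.1]), muk_eq_inv_mul_mukIntegral _ v h1]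
    · intro x hx
      have h1 : u - x ≤ 1 := by
        by_contra h
        exact hx.2 ⟨hx.1.1, by linarith⟩
      simp [mukIntegral, Vk_eq_empty h1]

theorem continuousOn_mukRec (v : ℝ) (k : ℕ) : ContinuousOn (mukRec v k) (Set.Icc 1 2) := by
  have hinv : ContinuousOn (fun u : ℝ => u⁻¹) (Set.Icc 1 2) :=
    continuousOn_id.inv₀ fun x hx => by
      have := hx.1
      simp only [id]
      linarith
  cases k with
  | zero => exact hinv.mul (by fun_prop)
  | succ k =>
    refine hinv.mul ?_
    have h12 : Set.uIcc (1 : ℝ) 2 = Set.Icc 1 2 := Set.uIcc_of_le (by norm_num)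
    rw [← h12]
    refine intervalIntegral.continuousOn_primitive_interval ?_
    rw [h12]
    exact (continuousOn_mukRec v k).integrableOn_Icc

theorem intervalIntegrable_mukRec (v : ℝ) (k : ℕ) {u : ℝ} (hu : 1 ≤ u) (hu2 : u ≤ 2) :
    IntervalIntegrable (mukRec v k) volume 1 u := by
  refine ContinuousOn.intervalIntegrable ?_
  rw [Set.uIcc_of_le hu]
  exact (continuousOn_mukRec v k).mono (Set.Icc_subset_Icc_right hu2)

theorem mukRec_nonneg {v : ℝ} (hv : v < 1) (k : ℕ) {u : ℝ} (hu : 1 ≤ u) (hu2 : u ≤ 2) :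
    0 ≤ mukRec v k u := by
  induction k generalizing u with
  | zero =>
    have hle : u - 1 ≤ min 1 (u - v) := le_min (by linarith) (by linarith)
    exact mul_nonneg (inv_nonneg.2 (by linarith)) (sub_nonneg.2 hle)
  | succ k ih =>
    exact mul_nonneg (inv_nonneg.2 (by linarith))
      (intervalIntegral.integral_nonneg hu fun w hw => ih hw.1 (hw.2.trans hu2))

/-- The sum of the series `∑ μ_k(u,v)` on `1 ≤ u ≤ 2`. -/
noncomputable def muSum (v u : ℝ) : ℝ := 1 - v + Real.log (1 + v) - Real.log (max (1 + v) u)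

theorem continuous_muSum {v : ℝ} (hv0 : 0 ≤ v) : Continuous (muSum v) := by
  refine continuous_const.sub (Continuous.log (by fun_prop) fun u => ?_)
  exact (lt_of_lt_of_le (by linarith) (le_max_left (1 + v) u)).ne'

theorem integral_muSum_of_le {v u : ℝ} (hu1 : 1 ≤ u) (hu : u ≤ 1 + v) :
    ∫ w in (1 : ℝ)..u, muSum v w = (u - 1) * (1 - v) := by
  rw [intervalIntegral.integral_congr (g := fun _ => 1 - v)]
  · rw [intervalIntegral.integral_const, smul_eq_mul]
  · intro w hw
    rw [Set.uIcc_of_le hu1] at hw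
    simp [muSum, max_eq_left (hw.2.trans hu)]

theorem integral_muSum_of_ge {v u : ℝ} (hv0 : 0 ≤ v) (hu : 1 + v ≤ u) :
    ∫ w in (1 : ℝ)..u, muSum v w = u * muSum v u + u - 2 := by
  have hI := fun a b => (continuous_muSum hv0).intervalIntegrable (μ := volume) a b
  rw [← intervalIntegral.integral_add_adjacent_intervals (hI 1 (1 + v)) (hI (1 + v) u),
    integral_muSum_of_le (by linarith) le_rfl,
    intervalIntegral.integral_congr (a := 1 + v) (b := u)
      (g := fun w => 1 - v + Real.log (1 + v) - Real.log w),
    intervalIntegral.integral_sub (by simp) intervalIntegral.intervalIntegrable_log',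
    integral_log, muSum, max_eq_right hu]
  · simp
    ring
  · intro w hw
    rw [Set.uIcc_of_le hu] at hw
    simp [muSum, max_eq_right hw.1]

theorem muSum_eq {v u : ℝ} (hv0 : 0 ≤ v) (hu1 : 1 ≤ u) :
    muSum v u = mukRec v 0 u + u⁻¹ * ∫ w in (1 : ℝ)..u, muSum v w := by
  have hu0 : u ≠ 0 := by linarith
  rcases le_total u (1 + v) with h | h
  · rw [integral_muSum_of_le hu1 h, mukRec, min_eq_right (by linarith), muSum, max_eq_left h]
    field_simp
    ring
  · rw [integral_muSum_of_ge hv0 h, mukRec, min_eq_left (by linarith)]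
    field_simp
    ring

theorem muSum_sub_sum_succ {v u : ℝ} (hv0 : 0 ≤ v) (hu1 : 1 ≤ u) (hu2 : u ≤ 2) (n : ℕ) :
    muSum v u - ∑ k ∈ Finset.range (n + 1), mukRec v k u =
      u⁻¹ * ∫ w in (1 : ℝ)..u, (muSum v w - ∑ k ∈ Finset.range n, mukRec v k w) := by
  have hI := fun k => intervalIntegrable_mukRec v k hu1 hu2
  rw [intervalIntegral.integral_sub ((continuous_muSum hv0).intervalIntegrable 1 u)
      (by simpa [Finset.sum_fn] using
        IntervalIntegrable.sum (Finset.range n) fun k _ => hI k),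
    intervalIntegral.integral_finsetSum fun k _ => hI k, Finset.sum_range_succ', muSum_eq hv0 hu1,
    mul_sub, Finset.mul_sum]
  simp only [mukRec]
  ring

theorem abs_muSum_sub_sum_le {v : ℝ} (hv0 : 0 ≤ v) {C : ℝ}
    (hC : ∀ u ∈ Set.Icc (1 : ℝ) 2, |muSum v u| ≤ C) (n : ℕ) {u : ℝ} (hu1 : 1 ≤ u)
    (hu2 : u ≤ 2) :
    |muSum v u - ∑ k ∈ Finset.range n, mukRec v k u| ≤ C * (1 / 2) ^ n := by
  induction n generalizing u with
  | zero => simpa using hC u ⟨hu1, hu2⟩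
  | succ n ih =>
    have hC0 : 0 ≤ C := (abs_nonneg _).trans (hC 1 ⟨le_rfl, by norm_num⟩)
    have hb := intervalIntegral.norm_integral_le_of_norm_le_const (a := 1) (b := u)
      (f := fun w => muSum v w - ∑ k ∈ Finset.range n, mukRec v k w)
      (C := C * (1 / 2) ^ n) fun w hw => by
        rw [Set.uIoc_of_le hu1] at hw
        exact ih hw.1.le (hw.2.trans hu2)
    rw [Real.norm_eq_abs, abs_of_nonneg (by linarith : 0 ≤ u - 1)] at hb
    have hu0 : 0 < u := by linarith
    rw [muSum_sub_sum_succ hv0 hu1 hu2, abs_mul, abs_of_pos (inv_pos.2 hu0), inv_mul_le_iff₀ hu0]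
    refine hb.trans ?_
    have hD : 0 ≤ C * (1 / 2) ^ n := by positivity
    rw [pow_succ]
    nlinarith

theorem hasSum_mukRec {v : ℝ} (hv0 : 0 ≤ v) (hv : v < 1) {u : ℝ} (hu1 : 1 ≤ u)
    (hu2 : u ≤ 2) : HasSum (fun k => mukRec v k u) (muSum v u) := by
  obtain ⟨C, hC⟩ := (isCompact_Icc (a := (1 : ℝ)) (b := 2)).exists_bound_of_continuousOn
    (continuous_muSum hv0).continuousOn
  rw [hasSum_iff_tendsto_nat_of_nonneg fun k => mukRec_nonneg hv k hu1 hu2,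
    tendsto_iff_norm_sub_tendsto_zero]
  refine squeeze_zero (g := fun n => C * (1 / 2) ^ n) (fun _ => norm_nonneg _) (fun n => ?_) ?_
  · rw [norm_sub_rev]
    exact abs_muSum_sub_sum_le hv0 hC n hu1 hu2
  · simpa using (tendsto_pow_atTop_nhds_zero_of_lt_one (r := (1 / 2 : ℝ)) (by norm_num)
      (by norm_num)).const_mul C

/-- Explicit value of `μ^{(1)}` for `1 + v < u ≤ 2` (Proposition 3.4). -/
theorem mu1kappa_value (u v : ℝ) (hv0 : 0 ≤ v) (hv : v < 1)
    (hu1 : 1 + v < u) (hu2 : u ≤ 2) :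
    mukappa 1 u v = 1 - v + Real.log ((1 + v) / u) := by
  have hu : 1 < u := by linarith
  have hterm : ∀ k : ℕ, (1 : ℝ) ^ (k + 1) * muk (k + 1) u v = mukRec v k u := fun k => by
    rw [one_pow, one_mul, muk_eq_mukRec hv k hu hu2]
  rw [mukappa, tsum_congr hterm, (hasSum_mukRec hv0 hv hu.le hu2).tsum_eq, muSum,
    max_eq_right hu1.le, Real.log_div (by linarith) (by linarith)]
  ring
end
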